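/- arXiv:1003.5084 — 4 statements merged into one kernel-verified Lean document; each statement's English description precedes it below -/
import Mathlib

section
/- For all δ > 0 and ε > 0 there exists a smooth function ρ : [0,δ] → [0,1] with the following properties: ρ is nonincreasing, ρ is constant equal to 1 on a neighbourhood of 0, ρ is constant equal to 0 on a neighbourhood of δ, and |x·ρ'(x)| < ε for all x ∈ [0,δ]. -/
namespace Real.smoothTransition

theorem deriv_eq_zero_of_nonpos {x : ℝ} (hx : x ≤ 0) : deriv smoothTransition x = 0 := by
  refine IsLocalMin.deriv_eq_zero (Filter.Eventually.of_forall fun y => ?_)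
  rw [zero_of_nonpos hx]
  exact nonneg y

theorem deriv_eq_zero_of_one_le {x : ℝ} (hx : 1 ≤ x) : deriv smoothTransition x = 0 := by
  refine IsLocalMax.deriv_eq_zero (Filter.Eventually.of_forall fun y => ?_)
  rw [one_of_one_le hx]
  exact le_one y

theorem exists_abs_deriv_le : ∃ M : ℝ, 0 ≤ M ∧ ∀ x, |deriv smoothTransition x| ≤ M := by
  have hc : Continuous (deriv smoothTransition) :=
    (smoothTransition.contDiff (n := 1)).continuous_deriv le_rfl
  obtain ⟨M, hM⟩ := isCompact_Icc.exists_bound_of_continuousOn (hc.continuousOn (s := Set.Icc 0 1))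
  have hM0 : 0 ≤ M := (norm_nonneg _).trans (hM 0 (by simp))
  refine ⟨M, hM0, fun x => ?_⟩
  rcases le_total x 0 with h0 | h0
  · simpa [deriv_eq_zero_of_nonpos h0] using hM0
  rcases le_total 1 x with h1 | h1
  · simpa [deriv_eq_zero_of_one_le h1] using hM0
  exact hM x ⟨h0, h1⟩

end Real.smoothTransition

/-- A smooth step in the variable `log ((x ^ 2 + k) / δ ^ 2)`; for `k > 0` it has no singularity
at the origin. -/
noncomputable def logCutoff (δ c k x : ℝ) : ℝ :=
  Real.smoothTransition (-c * Real.log ((x ^ 2 + k) / δ ^ 2))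

namespace logCutoff

variable {δ c k : ℝ}

theorem contDiff (hδ : 0 < δ) (hk : 0 < k) {n : ℕ∞} : ContDiff ℝ n (logCutoff δ c k) := by
  refine Real.smoothTransition.contDiff.comp (contDiff_const.mul (ContDiff.log ?_ fun x => ?_))
  · fun_prop
  · positivity

theorem antitoneOn (hδ : 0 < δ) (hc : 0 < c) (hk : 0 < k) :
    AntitoneOn (logCutoff δ c k) (Set.Ici 0) := by
  intro x hx y _ hxy
  have hx : 0 ≤ x := hx
  refine Real.smoothTransition.monotone ?_
  have : Real.log ((x ^ 2 + k) / δ ^ 2) ≤ Real.log ((y ^ 2 + k) / δ ^ 2) :=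
    Real.log_le_log (by positivity) (by gcongr)
  nlinarith

theorem eq_one {x : ℝ} (hδ : 0 < δ) (hc : 0 < c) (hk : 0 < k)
    (h : x ^ 2 + k ≤ δ ^ 2 * Real.exp (-1 / c)) : logCutoff δ c k x = 1 := by
  refine Real.smoothTransition.one_of_one_le ?_
  have : Real.log ((x ^ 2 + k) / δ ^ 2) ≤ -1 / c := by
    rw [Real.log_le_iff_le_exp (by positivity), div_le_iff₀' (by positivity)]
    exact h
  rw [le_div_iff₀ hc] at this
  linarith

theorem eq_zero {x : ℝ} (hδ : 0 < δ) (hc : 0 < c) (h : δ ^ 2 ≤ x ^ 2 + k) :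
    logCutoff δ c k x = 0 := by
  refine Real.smoothTransition.zero_of_nonpos ?_
  have : 0 ≤ Real.log ((x ^ 2 + k) / δ ^ 2) :=
    Real.log_nonneg (by rwa [one_le_div (by positivity)])
  nlinarith

theorem deriv_eq (hδ : 0 < δ) (hk : 0 < k) (x : ℝ) :
    deriv (logCutoff δ c k) x =
      deriv Real.smoothTransition (-c * Real.log ((x ^ 2 + k) / δ ^ 2)) *
        (-c * (2 * x / (x ^ 2 + k))) := by
  have hS := ((Real.smoothTransition.contDiff (n := 1)).differentiable one_ne_zero
    (-c * Real.log ((x ^ 2 + k) / δ ^ 2))).hasDerivAt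
  have hg := (((((hasDerivAt_id x).pow 2).add_const k).div_const (δ ^ 2)).log
    (by simp only [id, Pi.pow_apply]; positivity)).const_mul (-c)
  refine ((hS.comp x hg).congr_deriv ?_).deriv
  have : x ^ 2 + k ≠ 0 := by positivity
  simp only [id, Pi.pow_apply]
  field_simp
  push_cast
  ring

theorem abs_mul_deriv_le {M : ℝ} (hδ : 0 < δ) (hc : 0 < c) (hk : 0 < k)
    (hM : ∀ y, |deriv Real.smoothTransition y| ≤ M) (x : ℝ) :
    |x * deriv (logCutoff δ c k) x| ≤ M * (2 * c) := by
  have hx : x ^ 2 / (x ^ 2 + k) ≤ 1 := (div_le_one (by positivity)).2 (by linarith)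
  have hx0 : 0 ≤ x ^ 2 / (x ^ 2 + k) := by positivity
  rw [deriv_eq hδ hk]
  set D := deriv Real.smoothTransition (-c * Real.log ((x ^ 2 + k) / δ ^ 2)) with hD
  have : x * (D * (-c * (2 * x / (x ^ 2 + k)))) = -(D * (2 * c * (x ^ 2 / (x ^ 2 + k)))) := by
    ring
  rw [this, abs_neg, abs_mul, abs_of_nonneg (by positivity : 0 ≤ 2 * c * (x ^ 2 / (x ^ 2 + k)))]
  have hM0 : 0 ≤ M := (abs_nonneg _).trans (hM 0)
  exact mul_le_mul (hM _) (mul_le_of_le_one_right (by positivity) hx) (by positivity) hM0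

end logCutoff

/-- Existence of a smooth nonincreasing cutoff function
`ρ : [0,δ] → [0,1]`, equal to `1` near `0` and `0` near `δ`, with
`|x·ρ'(x)| < ε` everywhere on `[0,δ]`. -/
theorem stmt1 (δ ε : ℝ) (hδ : 0 < δ) (hε : 0 < ε) :
    ∃ ρ : ℝ → ℝ, ContDiff ℝ (⊤ : ℕ∞) ρ ∧
      (∀ x ∈ Set.Icc (0:ℝ) δ, ρ x ∈ Set.Icc (0:ℝ) 1) ∧
      AntitoneOn ρ (Set.Icc 0 δ) ∧
      (∃ t : ℝ, 0 < t ∧ ∀ x ∈ Set.Icc (0:ℝ) δ, x < t → ρ x = 1) ∧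
      (∃ t : ℝ, 0 < t ∧ ∀ x ∈ Set.Icc (0:ℝ) δ, δ - x < t → ρ x = 0) ∧
      (∀ x ∈ Set.Icc (0:ℝ) δ, |x * deriv ρ x| < ε) := by
  obtain ⟨M, hM0, hM⟩ := Real.smoothTransition.exists_abs_deriv_le
  obtain ⟨c, hc, hcε⟩ : ∃ c : ℝ, 0 < c ∧ M * (2 * c) < ε := by
    refine ⟨ε / (2 * (M + 1)), by positivity, ?_⟩
    have : M * (2 * (ε / (2 * (M + 1)))) = M * ε / (M + 1) := by field_simp
    rw [this, div_lt_iff₀ (by positivity)]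
    nlinarith
  obtain ⟨k, hk, hkb⟩ : ∃ k : ℝ, 0 < k ∧ k + k = δ ^ 2 * Real.exp (-1 / c) :=
    ⟨δ ^ 2 * Real.exp (-1 / c) / 2, by positivity, by ring⟩
  refine ⟨logCutoff δ c k, logCutoff.contDiff hδ hk,
    fun x _ => ⟨Real.smoothTransition.nonneg _, Real.smoothTransition.le_one _⟩,
    (logCutoff.antitoneOn hδ hc hk).mono Set.Icc_subset_Ici_self,
    ⟨√k, Real.sqrt_pos.2 hk, fun x hx hxt => logCutoff.eq_one hδ hc hk ?_⟩,
    ⟨k / (2 * δ), by positivity, fun x hx hxt => logCutoff.eq_zero hδ hc ?_⟩,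
    fun x _ => (logCutoff.abs_mul_deriv_le hδ hc hk hM x).trans_lt hcε⟩
  · have := (Real.lt_sqrt hx.1).1 hxt
    linarith
  · rw [lt_div_iff₀ (by positivity)] at hxt
    nlinarith [sq_nonneg (δ - x)]
end

section
/- Fix 0 < δ < ε < 1/2, unit vectors k₋, k₊ ∈ ℂ, and a constant c > 0. Let P := [0,ε] ∪ [1−ε,1] and let h̄, ḡ : P → ℂ be smooth maps satisfying: h̄'(r)/|h̄'(r)| = k₋ and ⟨ḡ(r), i·k₋⟩ = c for all r ∈ [0,ε], and h̄'(r)/|h̄'(r)| = k₊ and ⟨ḡ(r), i·k₊⟩ = c for all r ∈ [1−ε,1]. Then for every smooth immersion h : [0,1] → ℂ with h = h̄ on P there exists a smooth map g : [0,1] → ℂ such that (h,g) satisfies the stabilization conditions on [0,1] and g = ḡ on [0,δ] ∪ [1−δ,1]; moreover g can be chosen so as to depend continuously on h with respect to the C¹-topology. -/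
/-- The real inner product `⟨z,w⟩ = Re (z · conj w)` on `ℂ ≅ ℝ²`. -/
noncomputable def rinner (z w : ℂ) : ℝ := (z * (starRingEnd ℂ) w).re

/-- The pair `(h,g)` satisfies the stabilization conditions on `S`:
`⟨g'(r), i·h'(r)⟩ = 0` and `⟨g(r), i·h'(r)⟩ > 0` for all `r ∈ S`. -/
def StabOn (h g : ℝ → ℂ) (S : Set ℝ) : Prop :=
  ∀ r ∈ S, rinner (deriv g r) (Complex.I * deriv h r) = 0 ∧
    0 < rinner (g r) (Complex.I * deriv h r)

/-- The `C¹`-norm of a map on `[0,1]`: `sup |f| + sup |f'|`. -/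
noncomputable def C1Norm (f : ℝ → ℂ) : ℝ :=
  (⨆ r : Set.Icc (0:ℝ) 1, ‖f r.1‖) + (⨆ r : Set.Icc (0:ℝ) 1, ‖deriv f r.1‖)

theorem rinner_eq (z w : ℂ) : rinner z w = z.re * w.re + z.im * w.im := by
  simp [rinner, Complex.mul_re]

theorem contDiff_rinner {f g : ℝ → ℂ} {n : WithTop ℕ∞} (hf : ContDiff ℝ n f) (hg : ContDiff ℝ n g) :
    ContDiff ℝ n (fun r => rinner (f r) (g r)) := by
  simp only [rinner_eq]
  exact ((Complex.reCLM.contDiff.comp hf).mul (Complex.reCLM.contDiff.comp hg)).add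
    ((Complex.imCLM.contDiff.comp hf).mul (Complex.imCLM.contDiff.comp hg))

theorem hasDerivAt_rinner {f g : ℝ → ℂ} {f' g' : ℂ} {r : ℝ} (hf : HasDerivAt f f' r)
    (hg : HasDerivAt g g' r) :
    HasDerivAt (fun r => rinner (f r) (g r)) (rinner f' (g r) + rinner (f r) g') r := by
  have h1 {f : ℝ → ℂ} {f' : ℂ} (hf : HasDerivAt f f' r) :
    HasDerivAt (fun r => (f r).re) f'.re r := Complex.reCLM.hasFDerivAt.comp_hasDerivAt r hf
  have h2 {f : ℝ → ℂ} {f' : ℂ} (hf : HasDerivAt f f' r) :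
    HasDerivAt (fun r => (f r).im) f'.im r := Complex.imCLM.hasFDerivAt.comp_hasDerivAt r hf
  simp only [rinner_eq]
  exact (((h1 hf).mul (h1 hg)).add ((h2 hf).mul (h2 hg))).congr_deriv (by ring)

theorem rinner_add_left (z z' w : ℂ) : rinner (z + z') w = rinner z w + rinner z' w := by
  simp [rinner_eq]; ring

theorem rinner_smul_left (t : ℝ) (z w : ℂ) : rinner (t * z) w = t * rinner z w := by
  simp [rinner_eq]; ring

theorem rinner_smul_right (t : ℝ) (z w : ℂ) : rinner z (t * w) = t * rinner z w := by
  simp [rinner_eq]; ring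

theorem rinner_self (z : ℂ) : rinner z z = ‖z‖ ^ 2 := by
  rw [rinner_eq, Complex.sq_norm, Complex.normSq_apply]

/-- A vector orthogonal to two nonzero mutually orthogonal vectors of `ℂ` vanishes. -/
theorem eq_zero_of_rinner_eq_zero {z u w : ℂ} (hu : u ≠ 0) (hw : w ≠ 0) (huw : rinner u w = 0)
    (hzu : rinner z u = 0) (hzw : rinner z w = 0) : z = 0 := by
  have hu' : 0 < u.re ^ 2 + u.im ^ 2 := by
    have := Complex.normSq_pos.2 hu
    rw [Complex.normSq_apply] at this; nlinarith
  have hw' : 0 < w.re ^ 2 + w.im ^ 2 := by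
    have := Complex.normSq_pos.2 hw
    rw [Complex.normSq_apply] at this; nlinarith
  rw [rinner_eq] at *
  have key : (z.re ^ 2 + z.im ^ 2) * ((u.re ^ 2 + u.im ^ 2) * (w.re ^ 2 + w.im ^ 2)) = 0 := by
    grind
  have h0 : z.re ^ 2 + z.im ^ 2 = 0 := by
    rcases mul_eq_zero.1 key with h | h
    · exact h
    · exact absurd h (by positivity)
  apply Complex.ext <;> simp <;> nlinarith

/-- If `z` is orthogonal to `i v`, then `z` is the real multiple of `v` given by projection. -/
theorem rinner_div_mul_self {z v : ℂ} (hv : v ≠ 0) (h : rinner z (Complex.I * v) = 0) :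
    ((rinner z v / ‖v‖ ^ 2 : ℝ) : ℂ) * v = z := by
  have hv' : ‖v‖ ^ 2 ≠ 0 := by positivity
  have hvv : ‖v‖ ^ 2 = v.re * v.re + v.im * v.im := by rw [← rinner_self, rinner_eq]
  rw [rinner_eq] at h
  simp only [Complex.mul_re, Complex.mul_im, Complex.I_re, Complex.I_im] at h
  apply Complex.ext
  · rw [Complex.re_ofReal_mul, div_mul_eq_mul_div, div_eq_iff hv', hvv, rinner_eq]
    linear_combination v.im * h
  · rw [Complex.im_ofReal_mul, div_mul_eq_mul_div, div_eq_iff hv', hvv, rinner_eq]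
    linear_combination (-v.re) * h

theorem deriv_eq_of_eqOn_Icc {F : Type*} [NormedAddCommGroup F] [NormedSpace ℝ F] {f g : ℝ → F}
    {a b r : ℝ} (hab : a < b) (hf : DifferentiableAt ℝ f r) (hg : DifferentiableAt ℝ g r)
    (h : Set.EqOn f g (Set.Icc a b)) (hr : r ∈ Set.Icc a b) : deriv f r = deriv g r := by
  have hu := uniqueDiffOn_Icc hab r hr
  rw [← hf.derivWithin hu, ← hg.derivWithin hu]
  exact derivWithin_congr h (h hr)

/-- Two vectors of the plane with vanishing determinant satisfy a nontrivial linear relation. -/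
theorem exists_relation_of_det_eq_zero {A B : ℂ} (h : A.re * B.im - A.im * B.re = 0) :
    ∃ w : ℂ, w ≠ 0 ∧ w.re * A + w.im * B = 0 := by
  by_cases hA : A = 0
  · exact ⟨1, one_ne_zero, by simp [hA]⟩
  · refine ⟨⟨rinner B A, -‖A‖ ^ 2⟩, fun h0 => hA ?_, ?_⟩
    · simpa using congrArg Complex.im h0
    · rw [← rinner_self, rinner_eq, rinner_eq]
      apply Complex.ext <;> simp
      · linear_combination A.im * h
      · linear_combination (-A.re) * h

/-- A smooth function vanishing exactly on `[0,1]` and positive elsewhere. -/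
noncomputable def outsideWeight (r : ℝ) : ℝ := expNegInvGlue (-r) + expNegInvGlue (r - 1)

theorem contDiff_outsideWeight : ContDiff ℝ (⊤ : ℕ∞) outsideWeight :=
  (expNegInvGlue.contDiff.comp contDiff_neg).add
    (expNegInvGlue.contDiff.comp (contDiff_id.sub contDiff_const))

theorem outsideWeight_eq_zero {r : ℝ} (hr : r ∈ Set.Icc (0 : ℝ) 1) : outsideWeight r = 0 := by
  rw [outsideWeight, expNegInvGlue.zero_of_nonpos (by linarith [hr.1]),
    expNegInvGlue.zero_of_nonpos (by linarith [hr.2]), add_zero]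

theorem outsideWeight_pos {r : ℝ} (hr : r ∉ Set.Icc (0 : ℝ) 1) : 0 < outsideWeight r := by
  rw [Set.mem_Icc, not_and_or, not_le, not_le] at hr
  rcases hr with hr | hr
  · exact add_pos_of_pos_of_nonneg (expNegInvGlue.pos_of_pos (by linarith))
      (expNegInvGlue.nonneg _)
  · exact add_pos_of_nonneg_of_pos (expNegInvGlue.nonneg _)
      (expNegInvGlue.pos_of_pos (by linarith))

/-- `‖v‖²`, corrected outside `[0,1]` to be positive on all of `ℝ`. -/
theorem exists_contDiff_pos_eq_norm_sq {v : ℝ → ℂ} (hv : ContDiff ℝ (⊤ : ℕ∞) v)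
    (hv0 : ∀ r ∈ Set.Icc (0 : ℝ) 1, v r ≠ 0) :
    ∃ D : ℝ → ℝ, ContDiff ℝ (⊤ : ℕ∞) D ∧ (∀ r, 0 < D r) ∧
      ∀ r ∈ Set.Icc (0 : ℝ) 1, D r = ‖v r‖ ^ 2 := by
  refine ⟨fun r => rinner (v r) (v r) + outsideWeight r,
    (contDiff_rinner hv hv).add contDiff_outsideWeight, fun r => ?_, fun r hr => ?_⟩
  · beta_reduce
    rw [rinner_self]
    by_cases hr : r ∈ Set.Icc (0 : ℝ) 1
    · have := hv0 r hr
      rw [outsideWeight_eq_zero hr]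
      positivity
    · have := outsideWeight_pos hr
      positivity
  · beta_reduce
    rw [rinner_self, outsideWeight_eq_zero hr, add_zero]

theorem contDiff_deriv {h : ℝ → ℂ} (hh : ContDiff ℝ (⊤ : ℕ∞) h) :
    ContDiff ℝ (⊤ : ℕ∞) (deriv h) := (contDiff_infty_iff_deriv.1 hh).2

theorem hasDerivAt_of_contDiff {h : ℝ → ℂ} (hh : ContDiff ℝ (⊤ : ℕ∞) h) (r : ℝ) :
    HasDerivAt h (deriv h r) r := ((contDiff_infty_iff_deriv.1 hh).1 r).hasDerivAt

theorem contDiff_ofReal_mul {f : ℝ → ℝ} {g : ℝ → ℂ} (hf : ContDiff ℝ (⊤ : ℕ∞) f)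
    (hg : ContDiff ℝ (⊤ : ℕ∞) g) : ContDiff ℝ (⊤ : ℕ∞) fun r => (f r : ℂ) * g r :=
  (Complex.ofRealCLM.contDiff.comp hf).mul hg

theorem rinner_deriv_eq_zero_of_eqOn_Icc {g : ℝ → ℂ} {w : ℂ} {a b c r : ℝ} (hab : a < b)
    (hg : ContDiff ℝ (⊤ : ℕ∞) g) (h : ∀ t ∈ Set.Icc a b, rinner (g t) w = c)
    (hr : r ∈ Set.Icc a b) : rinner (deriv g r) w = 0 := by
  have hd := hasDerivAt_rinner (hasDerivAt_of_contDiff hg r) (hasDerivAt_const r w)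
  have h2 := deriv_eq_of_eqOn_Icc (g := fun _ => c) hab hd.differentiableAt
    (differentiableAt_const c) h hr
  rw [hd.deriv, deriv_const] at h2
  simpa [rinner] using h2

/-- For a single immersion `h` with constant slopes `km`, `kp` near the ends, the rotated slope
of `h`, corrected tangentially near the ends, satisfies the stabilization conditions. Its derivative
vanishes in the middle if the slope of `h` stays orthogonal to a fixed vector. -/
theorem exists_stabilization {δ ε c : ℝ} {km kp : ℂ} {h gbar : ℝ → ℂ} (hδ : 0 < δ) (hδε : δ < ε)
    (hε : ε < 1 / 2) (hkm : ‖km‖ = 1) (hkp : ‖kp‖ = 1) (hc : 0 < c)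
    (hh : ContDiff ℝ (⊤ : ℕ∞) h) (hgbar : ContDiff ℝ (⊤ : ℕ∞) gbar)
    (hh0 : ∀ r ∈ Set.Icc (0 : ℝ) 1, deriv h r ≠ 0)
    (hm : ∀ r ∈ Set.Icc 0 ε, deriv h r = ‖deriv h r‖ * km ∧ rinner (gbar r) (Complex.I * km) = c)
    (hp : ∀ r ∈ Set.Icc (1 - ε) 1,
      deriv h r = ‖deriv h r‖ * kp ∧ rinner (gbar r) (Complex.I * kp) = c) :
    ∃ g : ℝ → ℂ, ContDiff ℝ (⊤ : ℕ∞) g ∧ StabOn h g (Set.Icc 0 1) ∧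
      Set.EqOn g gbar (Set.Icc 0 δ ∪ Set.Icc (1 - δ) 1) ∧
      ∀ w : ℂ, w ≠ 0 → (∀ r ∈ Set.Ioo δ (1 - δ), rinner (deriv h r) w = 0) →
        ∀ r ∈ Set.Ioo ε (1 - ε), deriv g r = 0 := by
  obtain ⟨D, hD, hDpos, hDeq⟩ := exists_contDiff_pos_eq_norm_sq (contDiff_deriv hh) hh0
  have hS : ∀ r ∈ Set.Icc (0 : ℝ) 1, √(D r) = ‖deriv h r‖ := fun r hr => by
    rw [hDeq r hr, Real.sqrt_sq (norm_nonneg _)]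
  set U : ℝ → ℂ := fun r => (((√(D r))⁻¹ : ℝ) : ℂ) * deriv h r with hU
  have hUs : ContDiff ℝ (⊤ : ℕ∞) U :=
    contDiff_ofReal_mul ((hD.sqrt fun r => (hDpos r).ne').inv
      fun r => (Real.sqrt_pos.2 (hDpos r)).ne') (contDiff_deriv hh)
  have hhU : ∀ r ∈ Set.Icc (0 : ℝ) 1, deriv h r = ‖deriv h r‖ * U r := fun r hr => by
    have : (‖deriv h r‖ : ℂ) ≠ 0 := by simpa using hh0 r hr
    simp only [hU, hS r hr]
    push_cast
    rw [mul_inv_cancel_left₀ this]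
  have hpos : ∀ r ∈ Set.Icc (0 : ℝ) 1, 0 < ‖deriv h r‖ := fun r hr => norm_pos_iff.2 (hh0 r hr)
  have hU1 : ∀ r ∈ Set.Icc (0 : ℝ) 1, rinner (U r) (U r) = 1 := fun r hr => by
    have h1 := congrArg norm (hhU r hr)
    rw [norm_mul, Complex.norm_real, norm_norm] at h1
    rw [rinner_self, mul_left_cancel₀ (hpos r hr).ne' (h1.symm.trans (mul_one _).symm), one_pow]
  have hUk : ∀ r ∈ Set.Icc (0 : ℝ) 1, ∀ k : ℂ, deriv h r = ‖deriv h r‖ * k → U r = k := by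
    intro r hr k hk
    have : (‖deriv h r‖ : ℂ) ≠ 0 := by simpa using hh0 r hr
    exact mul_left_cancel₀ this ((hhU r hr).symm.trans hk)
  set χm : ℝ → ℝ := fun r => Real.smoothTransition ((ε - r) / (ε - δ)) with hχm
  set χp : ℝ → ℝ := fun r => Real.smoothTransition ((r - (1 - ε)) / (ε - δ)) with hχp
  have hεδ : 0 < ε - δ := by linarith
  have hχm0 : ∀ r, ε ≤ r → χm r = 0 := fun r hr =>
    Real.smoothTransition.zero_of_nonpos (div_nonpos_of_nonpos_of_nonneg (by linarith) hεδ.le)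
  have hχp0 : ∀ r, r ≤ 1 - ε → χp r = 0 := fun r hr =>
    Real.smoothTransition.zero_of_nonpos (div_nonpos_of_nonpos_of_nonneg (by linarith) hεδ.le)
  have hχm1 : ∀ r, r ≤ δ → χm r = 1 := fun r hr =>
    Real.smoothTransition.one_of_one_le ((one_le_div hεδ).2 (by linarith))
  have hχp1 : ∀ r, 1 - δ ≤ r → χp r = 1 := fun r hr =>
    Real.smoothTransition.one_of_one_le ((one_le_div hεδ).2 (by linarith))
  have hχms : ContDiff ℝ (⊤ : ℕ∞) χm :=
    Real.smoothTransition.contDiff.comp ((contDiff_const.sub contDiff_id).div_const _)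
  have hχps : ContDiff ℝ (⊤ : ℕ∞) χp :=
    Real.smoothTransition.contDiff.comp ((contDiff_id.sub contDiff_const).div_const _)
  set g : ℝ → ℂ := fun r => (c : ℂ) * (Complex.I * U r)
    + χm r * (gbar r - c * (Complex.I * km)) + χp r * (gbar r - c * (Complex.I * kp)) with hg
  have hgs : ContDiff ℝ (⊤ : ℕ∞) g :=
    ((contDiff_const.mul (contDiff_const.mul hUs)).add
      (contDiff_ofReal_mul hχms (hgbar.sub contDiff_const))).add
      (contDiff_ofReal_mul hχps (hgbar.sub contDiff_const))
  have hik : ∀ k : ℂ, ‖k‖ = 1 → rinner (Complex.I * k) (Complex.I * k) = 1 := fun k hk => by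
    rw [rinner_self, norm_mul, Complex.norm_I, hk]; norm_num
  have htan : ∀ (k z : ℂ) (t : ℝ), ‖k‖ = 1 → rinner z (Complex.I * k) = c →
      rinner (c * (Complex.I * k) + t * (z - c * (Complex.I * k))) (Complex.I * k) = c := by
    intro k z t hk hz
    rw [rinner_add_left, rinner_smul_left, rinner_smul_left, sub_eq_add_neg, ← neg_mul,
      ← Complex.ofReal_neg, rinner_add_left, rinner_smul_left, hik k hk, hz]
    ring
  have hgm : ∀ r ∈ Set.Icc 0 ε, rinner (g r) (Complex.I * km) = c := fun r hr => by
    simp only [hg]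
    rw [hχp0 r (by linarith [hr.2]), hUk r ⟨hr.1, by linarith [hr.2]⟩ km (hm r hr).1,
      Complex.ofReal_zero, zero_mul, add_zero]
    exact htan km _ _ hkm (hm r hr).2
  have hgp : ∀ r ∈ Set.Icc (1 - ε) 1, rinner (g r) (Complex.I * kp) = c := fun r hr => by
    simp only [hg]
    rw [hχm0 r (by linarith [hr.1]), hUk r ⟨by linarith [hr.1], hr.2⟩ kp (hp r hr).1,
      Complex.ofReal_zero, zero_mul, add_zero]
    exact htan kp _ _ hkp (hp r hr).2
  have hmid : ∀ r ∈ Set.Ioo ε (1 - ε), g r = c * (Complex.I * U r) := fun r hr => by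
    simp only [hg]
    rw [hχm0 r hr.1.le, hχp0 r hr.2.le]
    simp
  have hmid' : ∀ r ∈ Set.Ioo ε (1 - ε), deriv g r = c * (Complex.I * deriv U r) := fun r hr => by
    have h1 : g =ᶠ[nhds r] fun r => c * (Complex.I * U r) :=
      Filter.eventuallyEq_of_mem (isOpen_Ioo.mem_nhds hr) hmid
    rw [h1.deriv_eq]
    exact (((hasDerivAt_of_contDiff hUs r).const_mul _).const_mul _).deriv
  have hUU' : ∀ r ∈ Set.Ioo (0 : ℝ) 1, rinner (deriv U r) (U r) = 0 := fun r hr => by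
    have hd := hasDerivAt_rinner (hasDerivAt_of_contDiff hUs r) (hasDerivAt_of_contDiff hUs r)
    have h1 : (fun r => rinner (U r) (U r)) =ᶠ[nhds r] fun _ => 1 :=
      Filter.eventuallyEq_of_mem (isOpen_Ioo.mem_nhds hr)
        fun t ht => hU1 t (Set.Ioo_subset_Icc_self ht)
    have h2 := hd.deriv.symm.trans h1.deriv_eq
    rw [deriv_const, rinner_eq, rinner_eq] at h2
    rw [rinner_eq]
    linarith
  refine ⟨g, hgs, fun r hr => ?_, ?_, fun w hw hwr r hr => ?_⟩
  · have hslope : ∀ k : ℂ, deriv h r = ‖deriv h r‖ * k →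
        Complex.I * deriv h r = ‖deriv h r‖ * (Complex.I * k) := fun k hk => by
      rw [mul_left_comm, ← hk]
    rcases le_or_gt r ε with h1 | h1
    · have hr' : r ∈ Set.Icc 0 ε := ⟨hr.1, h1⟩
      rw [hslope km (hm r hr').1, rinner_smul_right, rinner_smul_right, hgm r hr',
        rinner_deriv_eq_zero_of_eqOn_Icc (hδ.trans hδε) hgs hgm hr', mul_zero]
      exact ⟨rfl, mul_pos (hpos r hr) hc⟩
    · rcases le_or_gt (1 - ε) r with h2 | h2
      · have hr' : r ∈ Set.Icc (1 - ε) 1 := ⟨h2, hr.2⟩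
        rw [hslope kp (hp r hr').1, rinner_smul_right, rinner_smul_right, hgp r hr',
          rinner_deriv_eq_zero_of_eqOn_Icc (by linarith) hgs hgp hr', mul_zero]
        exact ⟨rfl, mul_pos (hpos r hr) hc⟩
      · have hI : ∀ z w : ℂ, rinner (Complex.I * z) (Complex.I * w) = rinner z w := fun z w => by
          simp [rinner_eq]; ring
        rw [hslope _ (hhU r hr), rinner_smul_right, rinner_smul_right, hmid r ⟨h1, h2⟩,
          hmid' r ⟨h1, h2⟩, rinner_smul_left, rinner_smul_left, hI, hI, hU1 r hr,
          hUU' r ⟨by linarith, by linarith⟩]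
        refine ⟨by simp, ?_⟩
        have := hpos r hr
        positivity
  · rintro r (hr | hr)
    · have hr' : r ∈ Set.Icc 0 ε := ⟨hr.1, hr.2.trans hδε.le⟩
      simp only [hg]
      rw [hχp0 r (by linarith [hr.2]), hχm1 r hr.2,
        hUk r ⟨hr.1, by linarith [hr.2]⟩ km (hm r hr').1]
      simp
    · have hr' : r ∈ Set.Icc (1 - ε) 1 := ⟨by linarith [hr.1], hr.2⟩
      simp only [hg]
      rw [hχm0 r (by linarith [hr.1]), hχp1 r hr.1,
        hUk r ⟨by linarith [hr.1], hr.2⟩ kp (hp r hr').1]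
      simp
  · have hrδ : r ∈ Set.Ioo δ (1 - δ) := ⟨by linarith [hr.1], by linarith [hr.2]⟩
    have hUw : ∀ t ∈ Set.Ioo δ (1 - δ), rinner (U t) w = 0 := fun t ht => by
      simp only [hU]
      rw [rinner_smul_left, hwr t ht, mul_zero]
    have hd : rinner (deriv U r) w = 0 :=
      rinner_deriv_eq_zero_of_eqOn_Icc (a := ε) (b := 1 - ε) (by linarith) hUs
        (fun t ht => hUw t ⟨by linarith [ht.1], by linarith [ht.2]⟩) (Set.Ioo_subset_Icc_self hr)
    have hr01 : r ∈ Set.Ioo (0 : ℝ) 1 := ⟨by linarith [hr.1], by linarith [hr.2]⟩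
    have hUne : U r ≠ 0 := fun h0 => by
      have := hU1 r (Set.Ioo_subset_Icc_self hr01)
      rw [h0, rinner_eq] at this
      simp at this
    rw [hmid' r hr, eq_zero_of_rinner_eq_zero hUne hw (hUw r hrδ) (hUU' r hr01) hd]
    simp

/-- The restriction of a continuous map to `[0,1]`. -/
def restrictIcc (f : ℝ → ℂ) (hf : Continuous f) : C(Set.Icc (0 : ℝ) 1, ℂ) :=
  ⟨fun r => f r, hf.comp continuous_subtype_val⟩

theorem continuous_IccExtend_coe (f : C(Set.Icc (0 : ℝ) 1, ℂ)) :
    Continuous (Set.IccExtend zero_le_one f) := f.continuous.Icc_extend'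

/-- The primitive vanishing at `0`, as a continuous linear operator on `C([0,1], ℂ)`. -/
noncomputable def primitive : C(Set.Icc (0 : ℝ) 1, ℂ) →L[ℝ] C(Set.Icc (0 : ℝ) 1, ℂ) :=
  LinearMap.mkContinuous
    { toFun := fun f => ⟨fun r => ∫ t in (0 : ℝ)..r, Set.IccExtend zero_le_one f t,
        (intervalIntegral.continuous_primitive
          (fun a b => (continuous_IccExtend_coe f).intervalIntegrable a b) 0).comp
          continuous_subtype_val⟩
      map_add' := fun f g => by
        ext r
        exact intervalIntegral.integral_add ((continuous_IccExtend_coe f).intervalIntegrable _ _)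
          ((continuous_IccExtend_coe g).intervalIntegrable _ _)
      map_smul' := fun a f => by
        ext r
        exact intervalIntegral.integral_smul a _ } 1 fun f => by
    rw [one_mul, ContinuousMap.norm_le _ (norm_nonneg f)]
    intro r
    refine (intervalIntegral.norm_integral_le_of_norm_le_const (C := ‖f‖)
      fun t _ => f.norm_coe_le_norm _).trans ?_
    rw [sub_zero, abs_of_nonneg r.2.1]
    exact mul_le_of_le_one_right (norm_nonneg f) r.2.2

theorem primitive_apply {f : C(Set.Icc (0 : ℝ) 1, ℂ)} {F : ℝ → ℂ}
    (hF : ∀ t : Set.Icc (0 : ℝ) 1, f t = F t) (r : Set.Icc (0 : ℝ) 1) :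
    primitive f r = ∫ t in (0 : ℝ)..r, F t := by
  refine intervalIntegral.integral_congr fun t ht => ?_
  rw [Set.uIcc_of_le r.2.1] at ht
  rw [Set.IccExtend_of_mem _ _ ⟨ht.1, ht.2.trans r.2.2⟩, hF]

theorem isOpen_setOf_rinner_pos :
    IsOpen {q : C(Set.Icc (0 : ℝ) 1, ℂ) × C(Set.Icc (0 : ℝ) 1, ℂ) |
      ∀ r, 0 < rinner (q.1 r) (Complex.I * q.2 r)} := by
  let x : C(ℂ, ℝ) := ⟨Complex.re, Complex.continuous_re⟩
  let y : C(ℂ, ℝ) := ⟨Complex.im, Complex.continuous_im⟩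
  have hx := ContinuousMap.continuous_postcomp (X := Set.Icc (0 : ℝ) 1) x
  have hy := ContinuousMap.continuous_postcomp (X := Set.Icc (0 : ℝ) 1) y
  have hc : Continuous fun q : C(Set.Icc (0 : ℝ) 1, ℂ) × C(Set.Icc (0 : ℝ) 1, ℂ) =>
      y.comp q.1 * x.comp q.2 - x.comp q.1 * y.comp q.2 :=
    ((hy.comp continuous_fst).mul (hx.comp continuous_snd)).sub
      ((hx.comp continuous_fst).mul (hy.comp continuous_snd))
  have ho := (ContinuousMap.isOpen_setOfPred_mapsTo (X := Set.Icc (0 : ℝ) 1) isCompact_univ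
    (isOpen_Ioi (a := (0 : ℝ)))).preimage hc
  convert ho using 1
  ext q
  refine ⟨fun h r _ => ?_, fun h r => ?_⟩
  · have := h r
    simp [rinner_eq, x, y] at this ⊢
    linarith
  · have := h (Set.mem_univ r)
    simp [rinner_eq, x, y] at this ⊢
    linarith

/-- The primitive of a smooth function is smooth. -/
theorem contDiff_integral {f : ℝ → ℂ} (hf : ContDiff ℝ (⊤ : ℕ∞) f) (z : ℂ) :
    ContDiff ℝ (⊤ : ℕ∞) (fun r => z + ∫ t in (0 : ℝ)..r, f t) ∧
      deriv (fun r => z + ∫ t in (0 : ℝ)..r, f t) = f := by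
  have hd : ∀ r, HasDerivAt (fun r => z + ∫ t in (0 : ℝ)..r, f t) (f r) r := fun r =>
    (hf.continuous.integral_hasStrictDerivAt 0 r).hasDerivAt.const_add z
  have hd' : deriv (fun r => z + ∫ t in (0 : ℝ)..r, f t) = f := funext fun r => (hd r).deriv
  refine ⟨contDiff_infty_iff_deriv.2 ⟨fun r => (hd r).differentiableAt, ?_⟩, hd'⟩
  rwa [hd']

/-- A smooth nonnegative function supported on `[δ, 1 - δ]` and positive in the interior. -/
noncomputable def innerBump (δ r : ℝ) : ℝ := expNegInvGlue (r - δ) * expNegInvGlue (1 - δ - r)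

theorem contDiff_innerBump (δ : ℝ) : ContDiff ℝ (⊤ : ℕ∞) (innerBump δ) :=
  (expNegInvGlue.contDiff.comp (contDiff_id.sub contDiff_const)).mul
    (expNegInvGlue.contDiff.comp (contDiff_const.sub contDiff_id))

theorem innerBump_nonneg (δ r : ℝ) : 0 ≤ innerBump δ r :=
  mul_nonneg (expNegInvGlue.nonneg _) (expNegInvGlue.nonneg _)

theorem innerBump_eq_zero_of_le {δ r : ℝ} (hr : r ≤ δ) : innerBump δ r = 0 := by
  rw [innerBump, expNegInvGlue.zero_of_nonpos (by linarith), zero_mul]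

theorem innerBump_eq_zero_of_ge {δ r : ℝ} (hr : 1 - δ ≤ r) : innerBump δ r = 0 := by
  rw [innerBump, expNegInvGlue.zero_of_nonpos (x := 1 - δ - r) (by linarith), mul_zero]

theorem innerBump_pos {δ r : ℝ} (hr : r ∈ Set.Ioo δ (1 - δ)) : 0 < innerBump δ r :=
  mul_pos (expNegInvGlue.pos_of_pos (by linarith [hr.1]))
    (expNegInvGlue.pos_of_pos (by linarith [hr.2]))

/-- The smooth immersions of `[0,1]` which agree with `hbar` near the ends. -/
def Admissible (ε : ℝ) (hbar h : ℝ → ℂ) : Prop :=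
  ContDiff ℝ (⊤ : ℕ∞) h ∧ (∀ r ∈ Set.Icc (0 : ℝ) 1, deriv h r ≠ 0) ∧
    Set.EqOn h hbar (Set.Icc 0 ε ∪ Set.Icc (1 - ε) 1)

/-- The derivatives on `[0,1]` of admissible immersions. -/
def derivSet (ε : ℝ) (hbar : ℝ → ℂ) : Set C(Set.Icc (0 : ℝ) 1, ℂ) :=
  {v | ∃ h, Admissible ε hbar h ∧ ∀ r : Set.Icc (0 : ℝ) 1, v r = deriv h r}

/-- The `1`-jets on `[0,1]` of the maps which stabilize an immersion with derivative `v` and agree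
with `gbar` near the ends. -/
def stabSet (δ : ℝ) (gbar : ℝ → ℂ) (v : C(Set.Icc (0 : ℝ) 1, ℂ)) :
    Set (C(Set.Icc (0 : ℝ) 1, ℂ) × C(Set.Icc (0 : ℝ) 1, ℂ)) :=
  {q | ∃ g, ContDiff ℝ (⊤ : ℕ∞) g ∧ Set.EqOn g gbar (Set.Icc 0 δ ∪ Set.Icc (1 - δ) 1) ∧
    (∀ r : Set.Icc (0 : ℝ) 1, q.1 r = g r ∧ q.2 r = deriv g r) ∧
    ∀ r : Set.Icc (0 : ℝ) 1, rinner (q.2 r) (Complex.I * v r) = 0 ∧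
      0 < rinner (q.1 r) (Complex.I * v r)}

theorem convex_stabSet (δ : ℝ) (gbar : ℝ → ℂ) (v : C(Set.Icc (0 : ℝ) 1, ℂ)) :
    Convex ℝ (stabSet δ gbar v) := by
  rintro q ⟨g, hg, hgbar, hgq, hst⟩ q' ⟨g', hg', hgbar', hgq', hst'⟩ a b ha hb hab
  have hab' : (a : ℂ) + b = 1 := by exact_mod_cast hab
  refine ⟨fun r => a * g r + b * g' r,
    (contDiff_const.mul hg).add (contDiff_const.mul hg'), fun r hr => ?_, fun r => ⟨?_, ?_⟩,
    fun r => ?_⟩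
  · beta_reduce
    rw [hgbar hr, hgbar' hr, ← add_mul, hab', one_mul]
  · simp [(hgq r).1, (hgq' r).1]
  · have hd := ((hasDerivAt_of_contDiff hg r).const_mul (a : ℂ)).add
      ((hasDerivAt_of_contDiff hg' r).const_mul (b : ℂ))
    refine Eq.trans ?_ hd.deriv.symm
    simp [(hgq r).2, (hgq' r).2]
  · simp only [Prod.fst_add, Prod.snd_add, Prod.smul_fst, Prod.smul_snd, ContinuousMap.add_apply,
      ContinuousMap.smul_apply, Complex.real_smul, rinner_add_left, rinner_smul_left, (hst r).1,
      (hst' r).1, mul_zero, add_zero, true_and]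
    have h1 := (hst r).2
    have h2 := (hst' r).2
    rcases ha.eq_or_lt with rfl | ha
    · have : b = 1 := by linarith
      subst this
      simpa using h2
    · positivity

theorem Admissible.deriv_eq {ε r : ℝ} {hbar h h' : ℝ → ℂ} (hε0 : 0 < ε)
    (hh : Admissible ε hbar h) (hh' : Admissible ε hbar h')
    (hr : r ∈ Set.Icc 0 ε ∪ Set.Icc (1 - ε) 1) : deriv h r = deriv h' r := by
  have hd := (hasDerivAt_of_contDiff hh.1 r).differentiableAt
  have hd' := (hasDerivAt_of_contDiff hh'.1 r).differentiableAt
  have he : Set.EqOn h h' (Set.Icc 0 ε ∪ Set.Icc (1 - ε) 1) := hh.2.2.trans hh'.2.2.symm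
  rcases hr with hr | hr
  · exact deriv_eq_of_eqOn_Icc hε0 hd hd' (he.mono Set.subset_union_left) hr
  · exact deriv_eq_of_eqOn_Icc (by linarith) hd hd' (he.mono Set.subset_union_right) hr

/-- If the weighted Gram matrix of the plane curve `v` is degenerate, then `v` is orthogonal to a
fixed vector on the support of the weight. -/
theorem exists_rinner_eq_zero_of_gram_det_eq_zero {δ : ℝ} {v : ℝ → ℂ} {A B : ℂ} (hδ : 0 < δ)
    (hv : ContDiff ℝ (⊤ : ℕ∞) v)
    (hA : A = ∫ t in (0 : ℝ)..1, ((innerBump δ t * (v t).re : ℝ) : ℂ) * v t)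
    (hB : B = ∫ t in (0 : ℝ)..1, ((innerBump δ t * (v t).im : ℝ) : ℂ) * v t)
    (hdet : A.re * B.im - A.im * B.re = 0) :
    ∃ w : ℂ, w ≠ 0 ∧ ∀ r ∈ Set.Ioo δ (1 - δ), rinner (v r) w = 0 := by
  obtain ⟨w, hw, hAB⟩ := exists_relation_of_det_eq_zero hdet
  refine ⟨w, hw, fun r hr => ?_⟩
  have hvc := hv.continuous
  have hχ := (contDiff_innerBump δ).continuous
  have hsum : (∫ t in (0 : ℝ)..1, ((innerBump δ t * rinner (v t) w : ℝ) : ℂ) * v t) = 0 := by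
    rw [← hAB, hA, hB, ← intervalIntegral.integral_const_mul,
      ← intervalIntegral.integral_const_mul, ← intervalIntegral.integral_add]
    · refine intervalIntegral.integral_congr fun t _ => ?_
      simp only [rinner_eq]
      push_cast
      ring
    · exact Continuous.intervalIntegrable (by fun_prop) _ _
    · exact Continuous.intervalIntegrable (by fun_prop) _ _
  have hcr : Continuous fun t => rinner (v t) w := by
    simp only [rinner_eq]
    fun_prop
  have hsq : (∫ t in (0 : ℝ)..1, innerBump δ t * rinner (v t) w ^ 2) = 0 := by
    let L : ℂ →L[ℝ] ℝ := w.re • Complex.reCLM + w.im • Complex.imCLM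
    have hL : (∫ t in (0 : ℝ)..1, L (((innerBump δ t * rinner (v t) w : ℝ) : ℂ) * v t)) =
        L (∫ t in (0 : ℝ)..1, ((innerBump δ t * rinner (v t) w : ℝ) : ℂ) * v t) :=
      L.intervalIntegral_comp_comm (Continuous.intervalIntegrable (by fun_prop) 0 1)
    rw [hsum, L.map_zero] at hL
    refine Eq.trans ?_ hL
    refine intervalIntegral.integral_congr fun t _ => ?_
    simp only [L, add_apply, smul_apply,
      Complex.reCLM_apply, Complex.imCLM_apply, Complex.re_ofReal_mul, Complex.im_ofReal_mul,
      smul_eq_mul, rinner_eq]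
    ring
  by_contra hne
  refine (intervalIntegral.integral_pos (f := fun t => innerBump δ t * rinner (v t) w ^ 2)
    zero_lt_one (hχ.mul (hcr.pow 2)).continuousOn
    (fun t _ => mul_nonneg (innerBump_nonneg δ t) (sq_nonneg _))
    ⟨r, ⟨by linarith [hr.1], by linarith [hr.2]⟩, ?_⟩).ne' hsq
  have := innerBump_pos hr
  positivity

/-- Near an admissible derivative `v₀`, the stabilizing jets can be chosen continuously. -/
theorem exists_local_selection {δ ε c : ℝ} {km kp : ℂ} {hbar gbar : ℝ → ℂ} (hδ : 0 < δ)
    (hδε : δ < ε) (hε : ε < 1 / 2) (hkm : ‖km‖ = 1) (hkp : ‖kp‖ = 1) (hc : 0 < c)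
    (hhbar : ContDiff ℝ (⊤ : ℕ∞) hbar) (hgbar : ContDiff ℝ (⊤ : ℕ∞) gbar)
    (hm : ∀ r ∈ Set.Icc 0 ε, deriv hbar r ≠ 0 ∧ deriv hbar r / (‖deriv hbar r‖ : ℂ) = km ∧
      rinner (gbar r) (Complex.I * km) = c)
    (hp : ∀ r ∈ Set.Icc (1 - ε) 1, deriv hbar r ≠ 0 ∧
      deriv hbar r / (‖deriv hbar r‖ : ℂ) = kp ∧ rinner (gbar r) (Complex.I * kp) = c)
    {v₀ : C(Set.Icc (0 : ℝ) 1, ℂ)} (hv₀ : v₀ ∈ derivSet ε hbar) :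
    ∃ U ∈ nhds v₀, ∃ Γ : C(Set.Icc (0 : ℝ) 1, ℂ) →
        C(Set.Icc (0 : ℝ) 1, ℂ) × C(Set.Icc (0 : ℝ) 1, ℂ),
      ContinuousOn Γ U ∧ ∀ v ∈ U, v ∈ derivSet ε hbar → Γ v ∈ stabSet δ gbar v := by
  obtain ⟨h₀, hh₀, hv₀h⟩ := hv₀
  have hslope : ∀ {z k : ℂ}, z ≠ 0 → z / (‖z‖ : ℂ) = k → z = ‖z‖ * k := fun {z k} hz hk => by
    rw [← hk, mul_div_cancel₀ z (by simpa using hz : (‖z‖ : ℂ) ≠ 0)]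
  have hbd : ∀ r ∈ Set.Icc 0 ε ∪ Set.Icc (1 - ε) 1, deriv h₀ r = deriv hbar r := fun r hr => by
    have hd := (hasDerivAt_of_contDiff hh₀.1 r).differentiableAt
    have hd' := (hasDerivAt_of_contDiff hhbar r).differentiableAt
    rcases hr with hr | hr
    · exact deriv_eq_of_eqOn_Icc (hδ.trans hδε) hd hd' (hh₀.2.2.mono Set.subset_union_left) hr
    · exact deriv_eq_of_eqOn_Icc (by linarith) hd hd' (hh₀.2.2.mono Set.subset_union_right) hr
  obtain ⟨g₀, hg₀, hst, hg₀bar, hdeg⟩ := exists_stabilization hδ hδε hε hkm hkp hc hh₀.1 hgbar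
    hh₀.2.1
    (fun r hr => by
      rw [hbd r (Or.inl hr)]
      exact ⟨hslope (hm r hr).1 (hm r hr).2.1, (hm r hr).2.2⟩)
    (fun r hr => by
      rw [hbd r (Or.inr hr)]
      exact ⟨hslope (hp r hr).1 (hp r hr).2.1, (hp r hr).2.2⟩)
  have hpos_nhds : ∀ {q : C(Set.Icc (0 : ℝ) 1, ℂ) → C(Set.Icc (0 : ℝ) 1, ℂ)},
      ContinuousAt q v₀ → (∀ r, q v₀ r = g₀ r) →
      ∀ᶠ v in nhds v₀, ∀ r, 0 < rinner (q v r) (Complex.I * v r) := fun {q} hq hq₀ =>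
    (hq.prodMk continuousAt_id).eventually_mem (isOpen_setOf_rinner_pos.mem_nhds fun r => by
      simp only [id, hq₀, hv₀h]
      exact (hst r r.2).2)
  set v₁ : ℝ → ℂ := deriv h₀ with hv₁
  have hv₁s : ContDiff ℝ (⊤ : ℕ∞) v₁ := contDiff_deriv hh₀.1
  set φ₁ : ℝ → ℝ := fun t => innerBump δ t * (v₁ t).re with hφ₁
  set φ₂ : ℝ → ℝ := fun t => innerBump δ t * (v₁ t).im with hφ₂
  have hφ₁s : ContDiff ℝ (⊤ : ℕ∞) φ₁ :=
    (contDiff_innerBump δ).mul (Complex.reCLM.contDiff.comp hv₁s)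
  have hφ₂s : ContDiff ℝ (⊤ : ℕ∞) φ₂ :=
    (contDiff_innerBump δ).mul (Complex.imCLM.contDiff.comp hv₁s)
  obtain ⟨D, hDs, hDpos, hDeq⟩ := exists_contDiff_pos_eq_norm_sq hv₁s hh₀.2.1
  set s₀ : ℝ → ℝ := fun t => rinner (deriv g₀ t) (v₁ t) / D t with hs₀
  have hs₀s : ContDiff ℝ (⊤ : ℕ∞) s₀ :=
    (contDiff_rinner (contDiff_deriv hg₀) hv₁s).div hDs fun t => (hDpos t).ne'
  have hs₀v : ∀ t ∈ Set.Icc (0 : ℝ) 1, (s₀ t : ℂ) * v₁ t = deriv g₀ t := fun t ht => by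
    simp only [hs₀, hDeq t ht]
    exact rinner_div_mul_self (hh₀.2.1 t ht) (hst t ht).1
  let cR : ∀ s : ℝ → ℝ, ContDiff ℝ (⊤ : ℕ∞) s → C(Set.Icc (0 : ℝ) 1, ℂ) := fun s hs =>
    restrictIcc (fun t => (s t : ℂ)) (Complex.continuous_ofReal.comp hs.continuous)
  let e : Set.Icc (0 : ℝ) 1 := ⟨1, zero_le_one, le_rfl⟩
  let I : ∀ s : ℝ → ℝ, ContDiff ℝ (⊤ : ℕ∞) s → C(Set.Icc (0 : ℝ) 1, ℂ) → ℂ := fun s hs v =>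
    primitive (cR s hs * v) e
  have hIc : ∀ s hs, Continuous (I s hs) := fun s hs =>
    (continuous_eval_const e).comp
      (primitive.continuous.comp (continuous_const.mul continuous_id))
  have hI : ∀ s hs v (f : ℝ → ℂ), (∀ t : Set.Icc (0 : ℝ) 1, v t = f t) →
      I s hs v = ∫ t in (0 : ℝ)..1, (s t : ℂ) * f t := fun s hs v f hf =>
    primitive_apply (F := fun t => (s t : ℂ) * f t) (fun t => by
      rw [ContinuousMap.mul_apply, hf]; rfl) e
  by_cases hdet : (I φ₁ hφ₁s v₀).re * (I φ₂ hφ₂s v₀).im - (I φ₁ hφ₁s v₀).im * (I φ₂ hφ₂s v₀).re = 0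
  · obtain ⟨w, hw, hvw⟩ := exists_rinner_eq_zero_of_gram_det_eq_zero hδ hv₁s
      (hI φ₁ hφ₁s v₀ v₁ hv₀h) (hI φ₂ hφ₂s v₀ v₁ hv₀h) hdet
    have hg₀mid := hdeg w hw hvw
    let q₀ := restrictIcc g₀ hg₀.continuous
    let q₁ := restrictIcc (deriv g₀) (contDiff_deriv hg₀).continuous
    refine ⟨_, hpos_nhds (q := fun _ => q₀) continuousAt_const fun r => rfl, fun _ => (q₀, q₁),
      continuousOn_const, ?_⟩
    rintro v hv ⟨h, hh, hvh⟩
    refine ⟨g₀, hg₀, hg₀bar, fun r => ⟨rfl, rfl⟩, fun r => ⟨?_, hv r⟩⟩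
    change rinner (deriv g₀ r) (Complex.I * v r) = 0
    by_cases hr : (r : ℝ) ∈ Set.Icc 0 ε ∪ Set.Icc (1 - ε) 1
    · rw [hvh, hh.deriv_eq (hδ.trans hδε) hh₀ hr]
      exact (hst r r.2).1
    · have hr' : (r : ℝ) ∈ Set.Ioo ε (1 - ε) := by
        simp only [Set.mem_union, Set.mem_Icc, r.2.1, r.2.2, true_and, and_true, not_or,
          not_le] at hr
        exact hr
      rw [hg₀mid r hr']
      simp [rinner_eq]
  · set Δ : C(Set.Icc (0 : ℝ) 1, ℂ) → ℂ := fun v => gbar 1 - gbar 0 - I s₀ hs₀s v with hΔ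
    set A := I φ₁ hφ₁s with hA
    set B := I φ₂ hφ₂s with hB
    have hΔc : Continuous Δ := continuous_const.sub (hIc s₀ hs₀s)
    have hAc : Continuous A := hIc φ₁ hφ₁s
    have hBc : Continuous B := hIc φ₂ hφ₂s
    set det : C(Set.Icc (0 : ℝ) 1, ℂ) → ℝ := fun v => (A v).re * (B v).im - (A v).im * (B v).re
      with hdetdef
    have hdetc : Continuous det := by fun_prop
    set a : C(Set.Icc (0 : ℝ) 1, ℂ) → ℝ :=
      fun v => ((Δ v).re * (B v).im - (Δ v).im * (B v).re) / det v with ha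
    set b : C(Set.Icc (0 : ℝ) 1, ℂ) → ℝ :=
      fun v => ((A v).re * (Δ v).im - (A v).im * (Δ v).re) / det v with hb
    have hac : ∀ v, det v ≠ 0 → ContinuousAt a v := fun v hv =>
      ContinuousAt.div (by fun_prop) hdetc.continuousAt hv
    have hbc : ∀ v, det v ≠ 0 → ContinuousAt b v := fun v hv =>
      ContinuousAt.div (by fun_prop) hdetc.continuousAt hv
    have hab : ∀ v, det v ≠ 0 → a v * A v + b v * B v = Δ v := fun v hv => by
      apply Complex.ext
      · simp only [Complex.add_re, Complex.re_ofReal_mul, ha, hb]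
        field_simp
        simp only [hdetdef]
        ring
      · simp only [Complex.add_im, Complex.im_ofReal_mul, ha, hb]
        field_simp
        simp only [hdetdef]
        ring
    let d : C(Set.Icc (0 : ℝ) 1, ℂ) → C(Set.Icc (0 : ℝ) 1, ℂ) := fun v =>
      (cR s₀ hs₀s + a v • cR φ₁ hφ₁s + b v • cR φ₂ hφ₂s) * v
    have hdc : ∀ v, det v ≠ 0 → ContinuousAt d v := fun v hv =>
      ((continuousAt_const.add ((hac v hv).smul continuousAt_const)).add
        ((hbc v hv).smul continuousAt_const)).mul continuousAt_id
    let q : C(Set.Icc (0 : ℝ) 1, ℂ) → C(Set.Icc (0 : ℝ) 1, ℂ) := fun v =>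
      ContinuousMap.const _ (gbar 0) + primitive (d v)
    have hqc : ∀ v, det v ≠ 0 → ContinuousAt q v := fun v hv =>
      continuousAt_const.add (primitive.continuous.continuousAt.comp (hdc v hv))
    have hI0 : ∀ {f : ℝ → ℂ} {x : ℝ → ℂ} {r : ℝ}, ContDiff ℝ (⊤ : ℕ∞) x → ∀ l : ℝ,
        (∀ t ∈ Set.uIcc l r, f t = deriv x t) → (∫ t in l..r, f t) = x r - x l :=
      fun {f x r} hx l hf => by
        rw [intervalIntegral.integral_congr hf]
        exact intervalIntegral.integral_eq_sub_of_hasDerivAt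
          (fun t _ => hasDerivAt_of_contDiff hx t)
          ((contDiff_deriv hx).continuous.intervalIntegrable _ _)
    have h0δ : (0 : ℝ) ∈ Set.Icc 0 δ ∪ Set.Icc (1 - δ) 1 := Or.inl ⟨le_rfl, hδ.le⟩
    have h1δ : (1 : ℝ) ∈ Set.Icc 0 δ ∪ Set.Icc (1 - δ) 1 := Or.inr ⟨by linarith, le_rfl⟩
    have hΔ₀ : Δ v₀ = 0 := by
      simp only [hΔ]
      rw [hI s₀ hs₀s v₀ v₁ hv₀h, hI0 hg₀ 0 fun t ht => hs₀v t (by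
        rwa [Set.uIcc_of_le zero_le_one] at ht), hg₀bar h0δ, hg₀bar h1δ, sub_self]
    have hq₀ : ∀ r, q v₀ r = g₀ r := fun r => by
      have hd₀ : ∀ t : Set.Icc (0 : ℝ) 1, d v₀ t = deriv g₀ t := fun t => by
        have ha₀ : a v₀ = 0 := by simp [ha, hΔ₀]
        have hb₀ : b v₀ = 0 := by simp [hb, hΔ₀]
        rw [← hs₀v t t.2, ← hv₀h]
        simp only [d, ContinuousMap.mul_apply, ContinuousMap.add_apply, ContinuousMap.smul_apply,
          ha₀, hb₀, zero_smul, add_zero]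
        rfl
      simp only [q, ContinuousMap.add_apply, ContinuousMap.const_apply]
      rw [primitive_apply hd₀, hI0 hg₀ 0 fun _ _ => rfl, hg₀bar h0δ, add_sub_cancel]
    refine ⟨{v | det v ≠ 0 ∧ ∀ r, 0 < rinner (q v r) (Complex.I * v r)},
      (hdetc.continuousAt.eventually_ne hdet).and (hpos_nhds (hqc v₀ hdet) hq₀),
      fun v => (q v, d v),
      fun v hv => ((hqc v hv.1).prodMk (hdc v hv.1)).continuousWithinAt, ?_⟩
    rintro v ⟨hv, hvpos⟩ ⟨h, hh, hvh⟩
    set σ : ℝ → ℝ := fun t => s₀ t + a v * φ₁ t + b v * φ₂ t with hσ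
    have hσs : ContDiff ℝ (⊤ : ℕ∞) σ :=
      (hs₀s.add (contDiff_const.mul hφ₁s)).add (contDiff_const.mul hφ₂s)
    set f : ℝ → ℂ := fun t => (σ t : ℂ) * deriv h t with hf
    have hfs : ContDiff ℝ (⊤ : ℕ∞) f := contDiff_ofReal_mul hσs (contDiff_deriv hh.1)
    have hdf : ∀ t : Set.Icc (0 : ℝ) 1, d v t = f t := fun t => by
      simp only [d, f, σ, cR, restrictIcc, ContinuousMap.mul_apply, ContinuousMap.add_apply,
        ContinuousMap.smul_apply, ContinuousMap.coe_mk, Complex.real_smul, hvh]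
      push_cast
      rfl
    obtain ⟨hgs, hgd⟩ := contDiff_integral hfs (gbar 0)
    have hqg : ∀ r, q v r = gbar 0 + ∫ t in (0 : ℝ)..r, f t := fun r => by
      simp only [q, ContinuousMap.add_apply, ContinuousMap.const_apply]
      rw [primitive_apply hdf]
    have hend : (∫ t in (0 : ℝ)..1, f t) = gbar 1 - gbar 0 := by
      have h1 : primitive (d v) e = I s₀ hs₀s v + (a v * A v + b v * B v) := by
        simp only [d, add_mul, smul_mul_assoc, map_add, map_smul, ContinuousMap.add_apply,
          ContinuousMap.smul_apply, Complex.real_smul, add_assoc]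
        rfl
      rw [hab v hv, hΔ, add_sub_cancel, primitive_apply hdf] at h1
      exact h1
    have hfbar : ∀ t ∈ Set.Icc 0 δ ∪ Set.Icc (1 - δ) 1, f t = deriv gbar t := fun t ht => by
      have htε : t ∈ Set.Icc 0 ε ∪ Set.Icc (1 - ε) 1 :=
        ht.imp (fun h => ⟨h.1, h.2.trans hδε.le⟩) fun h => ⟨by linarith [h.1], h.2⟩
      have ht01 : t ∈ Set.Icc (0 : ℝ) 1 := by
        rcases ht with h | h
        · exact ⟨h.1, by linarith [h.2]⟩
        · exact ⟨by linarith [h.1], h.2⟩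
      have hbump : innerBump δ t = 0 := by
        rcases ht with h | h
        · exact innerBump_eq_zero_of_le h.2
        · exact innerBump_eq_zero_of_ge h.1
      simp only [hf, hσ, hφ₁, hφ₂, hbump, zero_mul, mul_zero, add_zero]
      rw [hh.deriv_eq (hδ.trans hδε) hh₀ htε, hs₀v t ht01]
      have hd := (hasDerivAt_of_contDiff hg₀ t).differentiableAt
      have hd' := (hasDerivAt_of_contDiff hgbar t).differentiableAt
      rcases ht with h | h
      · exact deriv_eq_of_eqOn_Icc hδ hd hd' (hg₀bar.mono Set.subset_union_left) h
      · exact deriv_eq_of_eqOn_Icc (by linarith) hd hd' (hg₀bar.mono Set.subset_union_right) h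
    refine ⟨_, hgs, ?_, fun r => ⟨hqg r, ?_⟩, fun r => ⟨?_, hvpos r⟩⟩
    · rintro r (hr | hr)
      · beta_reduce
        rw [hI0 hgbar 0 fun t ht => ?_, add_sub_cancel]
        rw [Set.uIcc_of_le hr.1] at ht
        exact hfbar t (Or.inl ⟨ht.1, ht.2.trans hr.2⟩)
      · have hadd := intervalIntegral.integral_add_adjacent_intervals
          (hfs.continuous.intervalIntegrable (μ := MeasureTheory.volume) 0 r)
          (hfs.continuous.intervalIntegrable r 1)
        have hr1 : (∫ t in r..1, f t) = gbar 1 - gbar r := hI0 hgbar r fun t ht => by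
          rw [Set.uIcc_of_le hr.2] at ht
          exact hfbar t (Or.inr ⟨hr.1.trans ht.1, ht.2⟩)
        rw [hend, hr1] at hadd
        linear_combination hadd
    · rw [hgd]
      exact hdf r
    · change rinner (d v r) (Complex.I * v r) = 0
      rw [hdf, hvh]
      simp only [hf, rinner_smul_left]
      rw [rinner_eq]
      simp
      ring_nf
      simp

theorem C1Norm_nonneg (f : ℝ → ℂ) : 0 ≤ C1Norm f :=
  add_nonneg (Real.iSup_nonneg fun _ => norm_nonneg _) (Real.iSup_nonneg fun _ => norm_nonneg _)

theorem norm_deriv_le_C1Norm {f : ℝ → ℂ} (hf : ContDiff ℝ (⊤ : ℕ∞) f) (r : Set.Icc (0 : ℝ) 1) :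
    ‖deriv f r‖ ≤ C1Norm f := by
  have hc : Continuous fun r : Set.Icc (0 : ℝ) 1 => ‖deriv f r‖ :=
    ((contDiff_deriv hf).continuous.comp continuous_subtype_val).norm
  exact (le_ciSup (isCompact_range hc).bddAbove r).trans
    (le_add_of_nonneg_left (Real.iSup_nonneg fun _ => norm_nonneg _))

theorem C1Norm_le {f : ℝ → ℂ} {C : ℝ} (h : ∀ r : Set.Icc (0 : ℝ) 1, ‖f r‖ ≤ C)
    (h' : ∀ r : Set.Icc (0 : ℝ) 1, ‖deriv f r‖ ≤ C) : C1Norm f ≤ C + C :=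
  haveI : Nonempty (Set.Icc (0 : ℝ) 1) := ⟨0, le_rfl, zero_le_one⟩
  add_le_add (ciSup_le h) (ciSup_le h')

theorem deriv_sub_apply {f g : ℝ → ℂ} (hf : ContDiff ℝ (⊤ : ℕ∞) f)
    (hg : ContDiff ℝ (⊤ : ℕ∞) g) (r : ℝ) :
    deriv (fun t => f t - g t) r = deriv f r - deriv g r :=
  ((hasDerivAt_of_contDiff hf r).sub (hasDerivAt_of_contDiff hg r)).deriv

/-- stabilization with constant slopes near the boundary
(Lemma on stabilization for constant slope), with continuous dependence on
`h` in the `C¹`-topology. -/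
theorem stmt2 (δ ε : ℝ) (hδ : 0 < δ) (hδε : δ < ε) (hε : ε < 1/2)
    (km kp : ℂ) (hkm : ‖km‖ = 1) (hkp : ‖kp‖ = 1) (c : ℝ) (hc : 0 < c)
    (hbar gbar : ℝ → ℂ)
    (hbar_sm : ContDiff ℝ (⊤ : ℕ∞) hbar) (gbar_sm : ContDiff ℝ (⊤ : ℕ∞) gbar)
    (hyp_m : ∀ r ∈ Set.Icc (0:ℝ) ε, deriv hbar r ≠ 0 ∧
      deriv hbar r / (‖deriv hbar r‖ : ℂ) = km ∧
      rinner (gbar r) (Complex.I * km) = c)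
    (hyp_p : ∀ r ∈ Set.Icc (1 - ε) (1:ℝ), deriv hbar r ≠ 0 ∧
      deriv hbar r / (‖deriv hbar r‖ : ℂ) = kp ∧
      rinner (gbar r) (Complex.I * kp) = c) :
    ∃ G : (ℝ → ℂ) → (ℝ → ℂ),
      (∀ h : ℝ → ℂ, ContDiff ℝ (⊤ : ℕ∞) h →
        (∀ r ∈ Set.Icc (0:ℝ) 1, deriv h r ≠ 0) →
        Set.EqOn h hbar (Set.Icc 0 ε ∪ Set.Icc (1 - ε) 1) →
        (ContDiff ℝ (⊤ : ℕ∞) (G h) ∧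
          StabOn h (G h) (Set.Icc 0 1) ∧
          Set.EqOn (G h) gbar (Set.Icc 0 δ ∪ Set.Icc (1 - δ) 1))) ∧
      (∀ h : ℝ → ℂ, ContDiff ℝ (⊤ : ℕ∞) h →
        (∀ r ∈ Set.Icc (0:ℝ) 1, deriv h r ≠ 0) →
        Set.EqOn h hbar (Set.Icc 0 ε ∪ Set.Icc (1 - ε) 1) →
        ∀ η : ℝ, 0 < η → ∃ θ : ℝ, 0 < θ ∧
          ∀ h' : ℝ → ℂ, ContDiff ℝ (⊤ : ℕ∞) h' →
            (∀ r ∈ Set.Icc (0:ℝ) 1, deriv h' r ≠ 0) →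
            Set.EqOn h' hbar (Set.Icc 0 ε ∪ Set.Icc (1 - ε) 1) →
            C1Norm (fun r => h' r - h r) < θ →
            C1Norm (fun r => G h' r - G h r) < η) := by
  obtain ⟨Γ, hΓ⟩ : ∃ Γ : C(derivSet ε hbar,
      C(Set.Icc (0 : ℝ) 1, ℂ) × C(Set.Icc (0 : ℝ) 1, ℂ)), ∀ v, Γ v ∈ stabSet δ gbar v.1 := by
    refine exists_continuous_forall_mem_convex_of_local (X := derivSet ε hbar)
      (E := C(Set.Icc (0 : ℝ) 1, ℂ) × C(Set.Icc (0 : ℝ) 1, ℂ))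
      (t := fun v => stabSet δ gbar v.1) ?_ ?_
    · intro v
      exact convex_stabSet δ gbar v.1
    · intro v
      obtain ⟨U, hU, Γ, hΓ, hmem⟩ :=
        exists_local_selection hδ hδε hε hkm hkp hc hbar_sm gbar_sm hyp_m hyp_p v.2
      exact ⟨Subtype.val ⁻¹' U, continuousAt_subtype_val hU, fun v => Γ v,
        hΓ.comp continuous_subtype_val.continuousOn fun _ h => h, fun v hv => hmem v hv v.2⟩
  choose g hg hgbar hjet hstab using hΓ
  let D : ∀ h, Admissible ε hbar h → derivSet ε hbar := fun h hh =>
    ⟨restrictIcc (deriv h) (contDiff_deriv hh.1).continuous, h, hh, fun r => rfl⟩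
  classical
  refine ⟨fun h => if hh : Admissible ε hbar h then g (D h hh) else 0, ?_, ?_⟩
  · intro h h1 h2 h3
    have hh : Admissible ε hbar h := ⟨h1, h2, h3⟩
    simp only [dif_pos hh]
    refine ⟨hg _, fun r hr => ?_, hgbar _⟩
    have h4 := hstab (D h hh) ⟨r, hr⟩
    rwa [(hjet (D h hh) ⟨r, hr⟩).1, (hjet (D h hh) ⟨r, hr⟩).2] at h4
  · intro h h1 h2 h3 η hη
    have hh : Admissible ε hbar h := ⟨h1, h2, h3⟩
    obtain ⟨θ, hθ, hclose⟩ := Metric.continuous_iff.1 Γ.continuous (D h hh) (η / 2) (by linarith)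
    refine ⟨θ, hθ, fun h' h1' h2' h3' hlt => ?_⟩
    have hh' : Admissible ε hbar h' := ⟨h1', h2', h3'⟩
    simp only [dif_pos hh, dif_pos hh']
    have hdist : dist (D h' hh') (D h hh) < θ := by
      refine lt_of_le_of_lt ?_ hlt
      rw [Subtype.dist_eq, dist_eq_norm, ContinuousMap.norm_le _ (C1Norm_nonneg _)]
      intro r
      have := norm_deriv_le_C1Norm (h1'.sub h1) r
      rwa [deriv_sub_apply h1' h1] at this
    have hΓd := hclose _ hdist
    rw [dist_eq_norm] at hΓd
    refine (C1Norm_le (C := ‖Γ (D h' hh') - Γ (D h hh)‖) (fun r => ?_) fun r => ?_).trans_lt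
      (by linarith)
    · rw [← (hjet (D h' hh') r).1, ← (hjet (D h hh) r).1]
      exact (ContinuousMap.norm_coe_le_norm (Γ (D h' hh') - Γ (D h hh)).1 r).trans
        (norm_fst_le (Γ (D h' hh') - Γ (D h hh)))
    · rw [deriv_sub_apply (hg _) (hg _), ← (hjet (D h' hh') r).2, ← (hjet (D h hh) r).2]
      exact (ContinuousMap.norm_coe_le_norm (Γ (D h' hh') - Γ (D h hh)).2 r).trans
        (norm_snd_le (Γ (D h' hh') - Γ (D h hh)))
end

section
/- Every smooth immersion h : [0,1] → ℂ can be stabilized: for every constant c > 0 the map g(r) := i·c·h'(r)/|h'(r)| is smooth and the pair (h,g) satisfies the stabilization conditions on [0,1]; more precisely ⟨g'(r), i·h'(r)⟩ = 0 and ⟨g(r), i·h'(r)⟩ = c·|h'(r)| > 0 for all r ∈ [0,1]. -/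
theorem rinner_I_mul_ofReal_mul (c : ℝ) (z w : ℂ) :
    rinner (Complex.I * (c : ℂ) * z) (Complex.I * w) = c * inner ℝ w z := by
  simp only [rinner, Complex.inner, Complex.mul_re, Complex.mul_im, map_mul, Complex.conj_I,
    Complex.conj_re, Complex.conj_im, Complex.I_re, Complex.I_im, Complex.ofReal_re,
    Complex.ofReal_im, Complex.neg_re, Complex.neg_im]
  ring

/-- A curve of locally constant unit norm has velocity orthogonal to its position. -/
theorem inner_deriv_eq_zero_of_norm_eq_one {E : Type*} [NormedAddCommGroup E]
    [InnerProductSpace ℝ E] {v : ℝ → E} {v' : E} {r : ℝ} (hv : HasDerivAt v v' r)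
    (hnorm : ∀ᶠ s in nhds r, ‖v s‖ = 1) : inner ℝ (v r) v' = 0 := by
  have hconst : HasDerivAt (fun s => ‖v s‖ ^ 2) 0 r :=
    (hasDerivAt_const r (1 : ℝ)).congr_of_eventuallyEq
      (hnorm.mono fun s hs => by simp [hs])
  have := hv.norm_sq.unique hconst
  linarith

theorem contDiffAt_div_ofReal_norm {f : ℝ → ℂ} {r : ℝ} {n : WithTop ℕ∞}
    (hf : ContDiffAt ℝ n f r) (hr : f r ≠ 0) :
    ContDiffAt ℝ n (fun s => f s / (‖f s‖ : ℂ)) r := by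
  have hnorm : ContDiffAt ℝ n (fun s => (‖f s‖ : ℂ)) r :=
    Complex.ofRealCLM.contDiff.contDiffAt.comp r (hf.norm ℝ hr)
  simp only [div_eq_mul_inv]
  exact hf.mul (hnorm.inv (by simpa using hr))

/-- every smooth immersion `h : [0,1] → ℂ` is stabilized by the
Wadsley-type form `g(r) = i·c·h'(r)/|h'(r)|`: `g` is smooth on `[0,1]`,
`⟨g'(r), i·h'(r)⟩ = 0` and `⟨g(r), i·h'(r)⟩ = c·|h'(r)| > 0`. -/
theorem stmt5 (h : ℝ → ℂ) (h_sm : ContDiff ℝ (⊤ : ℕ∞) h)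
    (himm : ∀ r ∈ Set.Icc (0:ℝ) 1, deriv h r ≠ 0) (c : ℝ) (hc : 0 < c) :
    ContDiffOn ℝ (⊤ : ℕ∞)
      (fun r => Complex.I * (c : ℂ) * (deriv h r / (‖deriv h r‖ : ℂ))) (Set.Icc 0 1) ∧
    ∀ r ∈ Set.Icc (0:ℝ) 1,
      rinner (deriv (fun r => Complex.I * (c : ℂ) * (deriv h r / (‖deriv h r‖ : ℂ))) r)
        (Complex.I * deriv h r) = 0 ∧
      rinner (Complex.I * (c : ℂ) * (deriv h r / (‖deriv h r‖ : ℂ)))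
        (Complex.I * deriv h r) = c * ‖deriv h r‖ ∧
      0 < c * ‖deriv h r‖ := by
  have hsmooth : ContDiff ℝ (⊤ : ℕ∞) (deriv h) := (contDiff_infty_iff_deriv.1 h_sm).2
  have hunit : ∀ r ∈ Set.Icc (0 : ℝ) 1,
      ContDiffAt ℝ (⊤ : ℕ∞) (fun s => deriv h s / (‖deriv h s‖ : ℂ)) r := fun r hr =>
    contDiffAt_div_ofReal_norm hsmooth.contDiffAt (himm r hr)
  refine ⟨fun r hr => (contDiffAt_const.mul (hunit r hr)).contDiffWithinAt, fun r hr => ?_⟩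
  have hpos : 0 < ‖deriv h r‖ := norm_pos_iff.2 (himm r hr)
  have hscale : deriv h r = ‖deriv h r‖ • (deriv h r / (‖deriv h r‖ : ℂ)) := by
    rw [Complex.real_smul, mul_div_cancel₀]
    exact_mod_cast hpos.ne'
  refine ⟨?_, ?_, mul_pos hc hpos⟩
  · have hdiff := (hunit r hr).differentiableAt (by simp)
    have hne : ∀ᶠ s in nhds r, deriv h s ≠ 0 :=
      hsmooth.continuous.continuousAt.eventually_ne (himm r hr)
    have horth := inner_deriv_eq_zero_of_norm_eq_one hdiff.hasDerivAt
      (hne.mono fun s hs => by simp [hs])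
    rw [deriv_const_mul _ hdiff, rinner_I_mul_ofReal_mul]
    conv_lhs => rw [hscale]
    rw [real_inner_smul_left, horth, mul_zero, mul_zero]
  · have hdiv : deriv h r / (‖deriv h r‖ : ℂ) = ‖deriv h r‖⁻¹ • deriv h r := by
      rw [Complex.real_smul, Complex.ofReal_inv, div_eq_inv_mul]
    rw [rinner_I_mul_ofReal_mul, hdiv, real_inner_smul_right, real_inner_self_eq_norm_sq]
    field_simp
end

section
/- Let h : [0,1] → ℂ be a smooth immersion whose slope h'/|h'| is not constant on [0,1], and let g₀, g₁ : [0,1] → ℂ be smooth maps such that both pairs (h,g₀) and (h,g₁) satisfy the stabilization conditions on [0,1]. Then there exists a smooth map g : [0,1] → ℂ which agrees with g₀ on a neighbourhood of 0 and with g₁ on a neighbourhood of 1 such that (h,g) satisfies the stabilization conditions on [0,1]. -/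
open scoped ContDiff

lemma rinner_I_mul (z w : ℂ) : rinner z (Complex.I * w) = z.im * w.re - z.re * w.im := by
  simp [rinner]

lemma exists_contDiff_primitive {f : ℝ → ℝ} (hf : ContDiff ℝ ∞ f) :
    ∃ F : ℝ → ℝ, ContDiff ℝ ∞ F ∧ ∀ x, HasDerivAt F (f x) x := by
  have key : ∀ x, HasDerivAt (fun y => ∫ t in (0:ℝ)..y, f t) (f x) x := fun x =>
    intervalIntegral.integral_hasDerivAt_right (hf.continuous.intervalIntegrable _ _)
      (hf.continuous.stronglyMeasurableAtFilter _ _) hf.continuous.continuousAt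
  refine ⟨_, ?_, key⟩
  rw [contDiff_infty_iff_deriv]
  refine ⟨fun x => (key x).differentiableAt, ?_⟩
  rwa [show deriv (fun y => ∫ t in (0:ℝ)..y, f t) = f from funext fun x => (key x).deriv]

/-- Solutions on an interval of the scalar linear equation `f' = G' • f` are multiples of `exp G`. -/
lemma exp_neg_smul_eq_of_hasDerivAt {E : Type*} [NormedAddCommGroup E] [NormedSpace ℝ E]
    {f : ℝ → E} {G k : ℝ → ℝ} {a b : ℝ}
    (hf : ∀ x ∈ Set.Icc a b, HasDerivAt f (k x • f x) x)
    (hG : ∀ x ∈ Set.Icc a b, HasDerivAt G (k x) x)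
    {x y : ℝ} (hx : x ∈ Set.Icc a b) (hy : y ∈ Set.Icc a b) :
    Real.exp (-G x) • f x = Real.exp (-G y) • f y := by
  have hd : ∀ x ∈ Set.Icc a b, HasDerivAt (fun x => Real.exp (-G x) • f x) 0 x := by
    intro x hx
    have := (hG x hx).neg.exp.smul (hf x hx)
    have h0 : Real.exp (-G x) • k x • f x + (Real.exp (-G x) * -k x) • f x = 0 := by
      rw [smul_smul, ← add_smul]
      simp
    exact h0 ▸ this
  have hc := constant_of_has_deriv_right_zero
    (fun x hx => (hd x hx).continuousAt.continuousWithinAt)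
    (fun x hx => (hd x (Set.Ico_subset_Icc_self hx)).hasDerivWithinAt)
  exact (hc x hx).trans (hc y hy).symm

/-- A smooth function vanishing exactly on `[0,1]` and positive elsewhere. -/
noncomputable def unitIntervalDefect (r : ℝ) : ℝ := expNegInvGlue (r - 1) + expNegInvGlue (-r)

lemma contDiff_unitIntervalDefect : ContDiff ℝ ∞ unitIntervalDefect :=
  (expNegInvGlue.contDiff.comp (contDiff_id.sub contDiff_const)).add
    (expNegInvGlue.contDiff.comp contDiff_neg)

lemma unitIntervalDefect_of_mem {r : ℝ} (hr : r ∈ Set.Icc (0:ℝ) 1) :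
    unitIntervalDefect r = 0 := by
  rw [unitIntervalDefect, expNegInvGlue.zero_of_nonpos (by linarith [hr.2]),
    expNegInvGlue.zero_of_nonpos (by linarith [hr.1]), add_zero]

lemma unitIntervalDefect_pos {r : ℝ} (hr : r ∉ Set.Icc (0:ℝ) 1) :
    0 < unitIntervalDefect r := by
  rw [Set.mem_Icc, not_and_or, not_le, not_le] at hr
  rcases hr with hr | hr
  · exact add_pos_of_nonneg_of_pos (expNegInvGlue.nonneg _) (expNegInvGlue.pos_of_pos (by linarith))
  · exact add_pos_of_pos_of_nonneg (expNegInvGlue.pos_of_pos (by linarith)) (expNegInvGlue.nonneg _)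

/-- A smooth function positive on `[0,1]` has a globally smooth reciprocal on `[0,1]`. -/
lemma exists_contDiff_mul_eq_one {f : ℝ → ℝ} (hf : ContDiff ℝ ∞ f)
    (hpos : ∀ r ∈ Set.Icc (0:ℝ) 1, 0 < f r) :
    ∃ m : ℝ → ℝ, ContDiff ℝ ∞ m ∧ ∀ r ∈ Set.Icc (0:ℝ) 1, f r * m r = 1 := by
  have hD := contDiff_unitIntervalDefect
  have hne : ∀ r, f r ^ 2 + unitIntervalDefect r ≠ 0 := by
    intro r
    by_cases hr : r ∈ Set.Icc (0:ℝ) 1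
    · rw [unitIntervalDefect_of_mem hr]
      have := hpos r hr
      positivity
    · have := unitIntervalDefect_pos hr
      positivity
  refine ⟨fun r => f r * (f r ^ 2 + unitIntervalDefect r)⁻¹,
    hf.mul (((hf.pow 2).add hD).inv hne), fun r hr => ?_⟩
  have := (hpos r hr).ne'
  simp only [unitIntervalDefect_of_mem hr]
  field_simp
  simp

/-- The derivative of the cross product `⟨g, i q⟩` along a curve `q` with `q' = (μ + κ i) q`. -/
lemma hasDerivAt_cross {g q : ℝ → ℂ} {g' : ℂ} {μ κ α r : ℝ}
    (hg : HasDerivAt g g' r)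
    (hq : HasDerivAt q ((μ + κ * Complex.I) * q r) r)
    (hα : (g r).re * (q r).re + (g r).im * (q r).im =
      α * ((g r).im * (q r).re - (g r).re * (q r).im)) :
    HasDerivAt (fun r => (g r).im * (q r).re - (g r).re * (q r).im)
      (g'.im * (q r).re - g'.re * (q r).im +
        (μ - κ * α) * ((g r).im * (q r).re - (g r).re * (q r).im)) r := by
  have hre {f : ℝ → ℂ} {f' : ℂ} (hf : HasDerivAt f f' r) : HasDerivAt (fun x => (f x).re) f'.re r :=
    Complex.reCLM.hasFDerivAt.comp_hasDerivAt r hf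
  have him {f : ℝ → ℂ} {f' : ℂ} (hf : HasDerivAt f f' r) : HasDerivAt (fun x => (f x).im) f'.im r :=
    Complex.imCLM.hasFDerivAt.comp_hasDerivAt r hf
  refine (((him hg).mul (hre hq)).sub ((hre hg).mul (him hq))).congr_deriv ?_
  simp only [Complex.mul_re, Complex.mul_im, Complex.add_re, Complex.add_im, Complex.ofReal_re,
    Complex.ofReal_im, Complex.I_re, Complex.I_im]
  linear_combination -κ * hα

/-- A complex number is determined by its cross product and cotangent relative to `w ≠ 0`. -/
lemma eq_cross_mul {z w : ℂ} {α m : ℝ}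
    (hm : (w.re ^ 2 + w.im ^ 2) * m = 1)
    (hα : z.re * w.re + z.im * w.im = α * (z.im * w.re - z.re * w.im)) :
    z = ((z.im * w.re - z.re * w.im) * m : ℝ) * ((α + Complex.I) * w) := by
  apply Complex.ext
  · simp only [Complex.mul_re, Complex.mul_im, Complex.add_re, Complex.add_im, Complex.ofReal_re,
      Complex.ofReal_im, Complex.I_re, Complex.I_im]
    linear_combination -z.re * hm + m * w.re * hα
  · simp only [Complex.mul_re, Complex.mul_im, Complex.add_re, Complex.add_im, Complex.ofReal_re,
      Complex.ofReal_im, Complex.I_re, Complex.I_im]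
    linear_combination -z.im * hm + m * w.im * hα

/-- The cotangent of a stabilizing map relative to `q = h'`, as a globally smooth function. -/
lemma StabOn.exists_cot {h g : ℝ → ℂ} (hq : ContDiff ℝ ∞ (deriv h)) (hg : ContDiff ℝ ∞ g)
    (hs : StabOn h g (Set.Icc 0 1)) :
    ∃ α : ℝ → ℝ, ContDiff ℝ ∞ α ∧ ∀ r ∈ Set.Icc (0:ℝ) 1,
      (g r).re * (deriv h r).re + (g r).im * (deriv h r).im =
        α r * ((g r).im * (deriv h r).re - (g r).re * (deriv h r).im) := by
  have hqr := Complex.reCLM.contDiff.comp hq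
  have hqi := Complex.imCLM.contDiff.comp hq
  have hgr := Complex.reCLM.contDiff.comp hg
  have hgi := Complex.imCLM.contDiff.comp hg
  obtain ⟨m, hm, hm1⟩ := exists_contDiff_mul_eq_one ((hgi.mul hqr).sub (hgr.mul hqi))
    (fun r hr => by
      have := (hs r hr).2
      rwa [rinner_I_mul] at this)
  refine ⟨_, ((hgr.mul hqr).add (hgi.mul hqi)).mul hm, fun r hr => ?_⟩
  have h1 := hm1 r hr
  simp only [Function.comp_apply, Complex.reCLM_apply, Complex.imCLM_apply] at h1 ⊢
  linear_combination (-((g r).re * (deriv h r).re + (g r).im * (deriv h r).im)) * h1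

/-- The logarithmic derivative of a nonvanishing smooth curve on `[0,1]`, split into its real and
imaginary parts. -/
lemma exists_log_deriv {q : ℝ → ℂ} {m : ℝ → ℝ} (hq : ContDiff ℝ ∞ q) (hm : ContDiff ℝ ∞ m)
    (hm1 : ∀ r ∈ Set.Icc (0:ℝ) 1, ((q r).re ^ 2 + (q r).im ^ 2) * m r = 1) :
    ∃ μ κ : ℝ → ℝ, ContDiff ℝ ∞ μ ∧ ContDiff ℝ ∞ κ ∧ ∀ r ∈ Set.Icc (0:ℝ) 1,
      HasDerivAt q ((μ r + κ r * Complex.I) * q r) r := by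
  have hq' : ContDiff ℝ ∞ (deriv q) := (contDiff_infty_iff_deriv.1 hq).2
  have hqr := Complex.reCLM.contDiff.comp hq
  have hqi := Complex.imCLM.contDiff.comp hq
  have hpr := Complex.reCLM.contDiff.comp hq'
  have hpi := Complex.imCLM.contDiff.comp hq'
  refine ⟨_, _, ((hpr.mul hqr).add (hpi.mul hqi)).mul hm,
    ((hpi.mul hqr).sub (hpr.mul hqi)).mul hm, fun r hr => ?_⟩
  have hd := (hq.differentiable (by simp) r).hasDerivAt
  refine hd.congr_deriv ?_
  have h1 := hm1 r hr
  apply Complex.ext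
  · simp only [Function.comp_apply, Complex.reCLM_apply, Complex.imCLM_apply,
      Complex.mul_re, Complex.mul_im, Complex.add_re, Complex.add_im, Complex.ofReal_re,
      Complex.ofReal_im, Complex.I_re, Complex.I_im]
    linear_combination (-(deriv q r).re) * h1
  · simp only [Function.comp_apply, Complex.reCLM_apply, Complex.imCLM_apply,
      Complex.mul_re, Complex.mul_im, Complex.add_re, Complex.add_im, Complex.ofReal_re,
      Complex.ofReal_im, Complex.I_re, Complex.I_im]
    linear_combination (-(deriv q r).im) * h1

/-- A curve with vanishing angular velocity has constant direction. -/
lemma div_norm_eq_of_hasDerivAt {q : ℝ → ℂ} {μ : ℝ → ℝ} (hμ : ContDiff ℝ ∞ μ)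
    (hq : ∀ r ∈ Set.Icc (0:ℝ) 1, HasDerivAt q (μ r • q r) r)
    {x y : ℝ} (hx : x ∈ Set.Icc (0:ℝ) 1) (hy : y ∈ Set.Icc (0:ℝ) 1) :
    q x / (‖q x‖ : ℂ) = q y / (‖q y‖ : ℂ) := by
  obtain ⟨G, -, hG⟩ := exists_contDiff_primitive hμ
  have key := exp_neg_smul_eq_of_hasDerivAt hq (fun x _ => hG x) hx hy
  have hdir (c : ℝ) (z : ℂ) : (Real.exp c • z) / (‖Real.exp c • z‖ : ℂ) = z / (‖z‖ : ℂ) := by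
    rw [norm_smul, Real.norm_of_nonneg (Real.exp_pos c).le, Complex.real_smul, Complex.ofReal_mul,
      mul_div_mul_left _ _ (Complex.ofReal_ne_zero.2 (Real.exp_pos c).ne')]
  rw [← hdir (-G x), key, hdir]

/-- A continuous function that is nonzero somewhere on `[0,1]` has positive weighted square
integral for some smooth weight supported away from the endpoints. -/
lemma exists_weight {κ : ℝ → ℝ} (hκ : ContDiff ℝ ∞ κ) (hne : ∃ r ∈ Set.Icc (0:ℝ) 1, κ r ≠ 0) :
    ∃ (ψ : ℝ → ℝ) (δ : ℝ), ContDiff ℝ ∞ ψ ∧ 0 < δ ∧ (∀ r ≤ δ, ψ r = 0) ∧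
      (∀ r, 1 - δ ≤ r → ψ r = 0) ∧ 0 < ∫ r in (0:ℝ)..1, ψ r * κ r ^ 2 := by
  obtain ⟨s, hs, hκs⟩ : ∃ s ∈ Set.Ioo (0:ℝ) 1, κ s ≠ 0 := by
    by_contra! hcon
    obtain ⟨r, hr, hκr⟩ := hne
    refine hκr ?_
    have hcl : Set.Icc (0:ℝ) 1 ⊆ {x | κ x = 0} := by
      rw [← closure_Ioo (zero_ne_one' ℝ)]
      exact closure_minimal hcon (isClosed_eq hκ.continuous continuous_const)
    exact hcl hr
  obtain ⟨δ, hδ, hδs⟩ := exists_between (lt_min hs.1 (sub_pos.2 hs.2))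
  rw [lt_min_iff] at hδs
  have hψ : ContDiff ℝ ∞ fun r => expNegInvGlue (r - δ) * expNegInvGlue (1 - δ - r) :=
    (expNegInvGlue.contDiff.comp (contDiff_id.sub contDiff_const)).mul
      (expNegInvGlue.contDiff.comp (contDiff_const.sub contDiff_id))
  refine ⟨_, δ, hψ, hδ, fun r hr => ?_, fun r hr => ?_, ?_⟩
  · simp [expNegInvGlue.zero_of_nonpos (sub_nonpos.2 hr)]
  · simp [expNegInvGlue.zero_of_nonpos (sub_nonpos.2 hr)]
  · refine intervalIntegral.integral_pos one_pos (hψ.mul (hκ.pow 2)).continuous.continuousOn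
      (fun x _ => ?_) ⟨s, Set.Ioo_subset_Icc_self hs, ?_⟩
    · exact mul_nonneg (mul_nonneg (expNegInvGlue.nonneg _) (expNegInvGlue.nonneg _)) (sq_nonneg _)
    · exact mul_pos (mul_pos (expNegInvGlue.pos_of_pos (by linarith))
        (expNegInvGlue.pos_of_pos (by linarith))) (by positivity)

/-- Interpolation of `α₀` and `α₁` with a prescribed value of `∫ (μ - κ α)` over `[0,1]`. -/
lemma exists_interpolation {μ κ α₀ α₁ : ℝ → ℝ} (hμ : ContDiff ℝ ∞ μ) (hκ : ContDiff ℝ ∞ κ)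
    (hα₀ : ContDiff ℝ ∞ α₀) (hα₁ : ContDiff ℝ ∞ α₁)
    (hne : ∃ r ∈ Set.Icc (0:ℝ) 1, κ r ≠ 0) (l₀ l₁ : ℝ) :
    ∃ (α G : ℝ → ℝ) (t : ℝ), ContDiff ℝ ∞ α ∧ ContDiff ℝ ∞ G ∧ 0 < t ∧ t ≤ 1 ∧ (∀ r ≤ t, α r = α₀ r) ∧ (∀ r, 1 - t ≤ r → α r = α₁ r) ∧
      (∀ r, HasDerivAt G (μ r - κ r * α r) r) ∧ G 0 = l₀ ∧ G 1 = l₁ := by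
  obtain ⟨ψ, δ, hψ, hδ, hψ0, hψ1, hint⟩ := exists_weight hκ hne
  have hχ : ContDiff ℝ ∞ fun r : ℝ => Real.smoothTransition (3 * r - 1) :=
    Real.smoothTransition.contDiff.comp ((contDiff_const.mul contDiff_id).sub contDiff_const)
  set χ := fun r : ℝ => Real.smoothTransition (3 * r - 1) with hχ_def
  have hα : ContDiff ℝ ∞ fun r => (1 - χ r) * α₀ r + χ r * α₁ r :=
    ((contDiff_const.sub hχ).mul hα₀).add (hχ.mul hα₁)
  obtain ⟨F, hF, hF'⟩ := exists_contDiff_primitive (hμ.sub (hκ.mul hα))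
  obtain ⟨K, hK, hK'⟩ := exists_contDiff_primitive (hψ.mul (hκ.pow 2))
  rw [intervalIntegral.integral_eq_sub_of_hasDerivAt (fun x _ => hK' x)
    ((hψ.mul (hκ.pow 2)).continuous.intervalIntegrable _ _)] at hint
  set c := (F 1 - F 0 + l₀ - l₁) / (K 1 - K 0) with hc
  have hc' : c * (K 1 - K 0) = F 1 - F 0 + l₀ - l₁ := div_mul_cancel₀ _ hint.ne'
  refine ⟨fun r => (1 - χ r) * α₀ r + χ r * α₁ r + c * (ψ r * κ r),
    fun r => l₀ + (F r - F 0) - c * (K r - K 0), min δ (1 / 3),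
    hα.add (contDiff_const.mul (hψ.mul hκ)),
    (contDiff_const.add (hF.sub contDiff_const)).sub
      (contDiff_const.mul (hK.sub contDiff_const)), by positivity,
    (min_le_right _ _).trans (by norm_num), fun r hr => ?_, fun r hr => ?_, fun r => ?_, by simp,
    by linarith⟩
  · have h1 : χ r = 0 := Real.smoothTransition.zero_of_nonpos
      (by linarith [min_le_right δ (1 / 3)])
    simp [h1, hψ0 r (hr.trans (min_le_left _ _))]
  · have h1 : χ r = 1 := Real.smoothTransition.one_of_one_le
      (by linarith [min_le_right δ (1 / 3)])
    simp [h1, hψ1 r (by linarith [min_le_left δ (1 / 3)])]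
  · refine ((((hF' r).sub_const (F 0)).const_add l₀).sub
      (((hK' r).sub_const (K 0)).const_mul c)).congr_deriv ?_
    simp only
    ring

/-- The cross product of a stabilizing map with `h'` is `exp G`, as soon as this holds at a point. -/
lemma StabOn.cross_eq_exp {h g : ℝ → ℂ} {μ κ α G : ℝ → ℝ} {a b : ℝ}
    (hg : ContDiff ℝ ∞ g) (hs : StabOn h g (Set.Icc a b))
    (hq : ∀ r ∈ Set.Icc a b, HasDerivAt (deriv h) ((μ r + κ r * Complex.I) * deriv h r) r)
    (hα : ∀ r ∈ Set.Icc a b, (g r).re * (deriv h r).re + (g r).im * (deriv h r).im =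
      α r * ((g r).im * (deriv h r).re - (g r).re * (deriv h r).im))
    (hG : ∀ r ∈ Set.Icc a b, HasDerivAt G (μ r - κ r * α r) r)
    {s : ℝ} (hs' : s ∈ Set.Icc a b)
    (hGs : Real.exp (G s) = (g s).im * (deriv h s).re - (g s).re * (deriv h s).im)
    {r : ℝ} (hr : r ∈ Set.Icc a b) :
    (g r).im * (deriv h r).re - (g r).re * (deriv h r).im = Real.exp (G r) := by
  have key := exp_neg_smul_eq_of_hasDerivAt
    (f := fun r => (g r).im * (deriv h r).re - (g r).re * (deriv h r).im) (G := G)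
    (fun x hx => by
      refine (hasDerivAt_cross (hg.differentiable (by simp) x).hasDerivAt
        (hq x hx) (hα x hx)).congr_deriv ?_
      have h0 := (hs x hx).1
      rw [rinner_I_mul] at h0
      rw [h0, zero_add, smul_eq_mul]) hG hr hs'
  simp only [smul_eq_mul, ← hGs, ← Real.exp_add, neg_add_cancel, Real.exp_zero] at key
  rw [Real.exp_neg, inv_mul_eq_one₀ (Real.exp_ne_zero _)] at key
  exact key.symm

/-- A map with cross product `exp G` and cotangent `α` relative to `h'` satisfies the stabilization
conditions if `G' = μ - κ α`. -/
lemma stabOn_of_cross_eq_exp {h g : ℝ → ℂ} {μ κ α G : ℝ → ℝ} (hg : ContDiff ℝ ∞ g)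
    (hq : ∀ r ∈ Set.Icc (0:ℝ) 1, HasDerivAt (deriv h) ((μ r + κ r * Complex.I) * deriv h r) r)
    (hα : ∀ r ∈ Set.Icc (0:ℝ) 1, (g r).re * (deriv h r).re + (g r).im * (deriv h r).im =
      α r * ((g r).im * (deriv h r).re - (g r).re * (deriv h r).im))
    (hG : ∀ r, HasDerivAt G (μ r - κ r * α r) r)
    (hB : ∀ r ∈ Set.Icc (0:ℝ) 1,
      (g r).im * (deriv h r).re - (g r).re * (deriv h r).im = Real.exp (G r)) :
    StabOn h g (Set.Icc 0 1) := by
  intro r hr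
  rw [rinner_I_mul, rinner_I_mul, hB r hr]
  refine ⟨?_, Real.exp_pos _⟩
  have h1 := (hasDerivAt_cross (hg.differentiable (by simp) r).hasDerivAt
    (hq r hr) (hα r hr)).hasDerivWithinAt (s := Set.Icc 0 1)
  have h2 := ((hG r).exp.hasDerivWithinAt (s := Set.Icc 0 1)).congr hB (hB r hr)
  have h3 := (uniqueDiffOn_Icc_zero_one r hr).eq_deriv _ h1 h2
  rw [hB r hr] at h3
  linear_combination h3

/-- if the slope of the immersion `h` is not constant on `[0,1]`,
then any two stabilizing maps `g₀, g₁` for `h` can be interpolated by a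
stabilizing map `g` agreeing with `g₀` near `0` and with `g₁` near `1`. -/
theorem stmt8 (h g₀ g₁ : ℝ → ℂ)
    (h_sm : ContDiff ℝ (⊤ : ℕ∞) h)
    (g₀_sm : ContDiff ℝ (⊤ : ℕ∞) g₀) (g₁_sm : ContDiff ℝ (⊤ : ℕ∞) g₁)
    (himm : ∀ r ∈ Set.Icc (0:ℝ) 1, deriv h r ≠ 0)
    (hnc : ∃ r₁ ∈ Set.Icc (0:ℝ) 1, ∃ r₂ ∈ Set.Icc (0:ℝ) 1,
      deriv h r₁ / (‖deriv h r₁‖ : ℂ) ≠ deriv h r₂ / (‖deriv h r₂‖ : ℂ))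
    (hstab0 : StabOn h g₀ (Set.Icc 0 1))
    (hstab1 : StabOn h g₁ (Set.Icc 0 1)) :
    ∃ g : ℝ → ℂ, ContDiff ℝ (⊤ : ℕ∞) g ∧
      (∃ t : ℝ, 0 < t ∧ Set.EqOn g g₀ (Set.Icc 0 t)) ∧
      (∃ t : ℝ, 0 < t ∧ Set.EqOn g g₁ (Set.Icc (1 - t) 1)) ∧
      StabOn h g (Set.Icc 0 1) := by
  have hq : ContDiff ℝ ∞ (deriv h) := (contDiff_infty_iff_deriv.1 h_sm).2
  obtain ⟨m, hm, hm1⟩ := exists_contDiff_mul_eq_one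
    (((Complex.reCLM.contDiff.comp hq).pow 2).add ((Complex.imCLM.contDiff.comp hq).pow 2))
    (fun r hr => by
      have := Complex.normSq_pos.2 (himm r hr)
      rw [Complex.normSq_apply] at this
      simp only [Function.comp_apply, Complex.reCLM_apply, Complex.imCLM_apply]
      linarith)
  simp only [Function.comp_apply, Complex.reCLM_apply, Complex.imCLM_apply] at hm1
  obtain ⟨μ, κ, hμ, hκ, hq'⟩ := exists_log_deriv hq hm hm1
  have hne : ∃ r ∈ Set.Icc (0:ℝ) 1, κ r ≠ 0 := by
    by_contra! hκ0
    obtain ⟨r₁, hr₁, r₂, hr₂, hne⟩ := hnc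
    refine hne (div_norm_eq_of_hasDerivAt hμ (fun r hr => ?_) hr₁ hr₂)
    simpa [hκ0 r hr] using hq' r hr
  obtain ⟨α₀, hα₀, hcot₀⟩ := hstab0.exists_cot hq g₀_sm
  obtain ⟨α₁, hα₁, hcot₁⟩ := hstab1.exists_cot hq g₁_sm
  have hz : (0:ℝ) ∈ Set.Icc (0:ℝ) 1 := by simp
  have ho : (1:ℝ) ∈ Set.Icc (0:ℝ) 1 := by simp
  have hpos₀ := (hstab0 0 hz).2
  have hpos₁ := (hstab1 1 ho).2
  rw [rinner_I_mul] at hpos₀ hpos₁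
  obtain ⟨α, G, t, hα, hG, ht, ht1, hαα₀, hαα₁, hG', hG0, hG1⟩ :=
    exists_interpolation hμ hκ hα₀ hα₁ hne
      (Real.log ((g₀ 0).im * (deriv h 0).re - (g₀ 0).re * (deriv h 0).im))
      (Real.log ((g₁ 1).im * (deriv h 1).re - (g₁ 1).re * (deriv h 1).im))
  have hsub₀ : Set.Icc 0 t ⊆ Set.Icc (0:ℝ) 1 := Set.Icc_subset_Icc_right ht1
  have hsub₁ : Set.Icc (1 - t) 1 ⊆ Set.Icc (0:ℝ) 1 := Set.Icc_subset_Icc_left (by linarith)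
  have hofReal {f : ℝ → ℝ} (hf : ContDiff ℝ ∞ f) : ContDiff ℝ ∞ fun r => (f r : ℂ) :=
    Complex.ofRealCLM.contDiff.comp hf
  set g : ℝ → ℂ := fun r => (Real.exp (G r) * m r : ℝ) * ((α r + Complex.I) * deriv h r)
    with hg_def
  have hg : ContDiff ℝ ∞ g :=
    (hofReal (hG.exp.mul hm)).mul (((hofReal hα).add contDiff_const).mul hq)
  have hB : ∀ r ∈ Set.Icc (0:ℝ) 1,
      (g r).im * (deriv h r).re - (g r).re * (deriv h r).im = Real.exp (G r) := by
    intro r hr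
    simp only [hg_def, Complex.mul_re, Complex.mul_im, Complex.add_re, Complex.add_im,
      Complex.ofReal_re, Complex.ofReal_im, Complex.I_re, Complex.I_im]
    linear_combination Real.exp (G r) * hm1 r hr
  refine ⟨g, hg, ⟨t, ht, fun r hr => ?_⟩, ⟨t, ht, fun r hr => ?_⟩,
    stabOn_of_cross_eq_exp hg hq' (fun r hr => ?_) hG' hB⟩
  · have key := StabOn.cross_eq_exp g₀_sm (fun x hx => hstab0 x (hsub₀ hx))
      (fun x hx => hq' x (hsub₀ hx)) (fun x hx => hcot₀ x (hsub₀ hx))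
      (fun x hx => hαα₀ x hx.2 ▸ hG' x) (Set.left_mem_Icc.2 ht.le)
      (by rw [hG0, Real.exp_log hpos₀]) hr
    rw [eq_cross_mul (hm1 r (hsub₀ hr)) (hcot₀ r (hsub₀ hr)), key, ← hαα₀ r hr.2]
  · have key := StabOn.cross_eq_exp g₁_sm (fun x hx => hstab1 x (hsub₁ hx))
      (fun x hx => hq' x (hsub₁ hx)) (fun x hx => hcot₁ x (hsub₁ hx))
      (fun x hx => hαα₁ x hx.1 ▸ hG' x) (Set.right_mem_Icc.2 (by linarith))
      (by rw [hG1, Real.exp_log hpos₁]) hr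
    rw [eq_cross_mul (hm1 r (hsub₁ hr)) (hcot₁ r (hsub₁ hr)), key, ← hαα₁ r hr.1]
  · simp only [hg_def, Complex.mul_re, Complex.mul_im, Complex.add_re, Complex.add_im,
      Complex.ofReal_re, Complex.ofReal_im, Complex.I_re, Complex.I_im]
    ring
end
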